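/- Let μ ∈ C([0,∞); P₂(ℝ²)) be a global measure-valued solution of the nonlocal continuity equation with F ∈ F^ν_{A,B,I,M}(κ,γ), and set μ̃_t := δ_{x_c(t)} ⊗ ν where x_c(t) := ∫ x μ_t(dx,dω). Then for all t ≥ 0, | d/dt x_c(t) − F[μ̃_t](x_c(t), ω_c) | ≤ ((κ+1)I + κM) W₁(μ_t, μ̃_t) + Iγ. -/

import Mathlib

set_option autoImplicit false

open MeasureTheory Set Real Filter

noncomputable section

/-- The (topological) support of a measure: points all of whose open neighborhoods
have positive measure. -/
def msupp {E : Type*} [TopologicalSpace E] [MeasurableSpace E] (μ : Measure E) : Set E :=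
  {z | ∀ U : Set E, IsOpen U → z ∈ U → μ U ≠ 0}

/-- `pl` is a coupling of `μ` and `ν`. -/
def IsCoupling {E F : Type*} [MeasurableSpace E] [MeasurableSpace F]
    (pl : Measure (E × F)) (μ : Measure E) (ν : Measure F) : Prop :=
  pl.map Prod.fst = μ ∧ pl.map Prod.snd = ν

/-- The 1-Wasserstein distance. -/
def W1 {E : Type*} [MeasurableSpace E] [PseudoMetricSpace E] (μ ν : Measure E) : ℝ :=
  ⨅ pl : {pl : Measure (E × E) // IsCoupling pl μ ν}, ∫ q, dist q.1 q.2 ∂(pl.1)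

/-- The 2-Wasserstein distance. -/
def W2 {E : Type*} [MeasurableSpace E] [PseudoMetricSpace E] (μ ν : Measure E) : ℝ :=
  ⨅ pl : {pl : Measure (E × E) // IsCoupling pl μ ν},
    Real.sqrt (∫ q, dist q.1 q.2 ^ 2 ∂(pl.1))

/-- Partial derivative `∂ₓ F[μ](x,ω)` of a nonlocal velocity field. -/
def Fx (F : Measure (ℝ × ℝ) → ℝ × ℝ → ℝ) (μ : Measure (ℝ × ℝ)) (z : ℝ × ℝ) : ℝ :=
  deriv (fun x => F μ (x, z.2)) z.1

/-- Second partial derivative `∂ₓ² F[μ](x,ω)`. -/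
def Fxx (F : Measure (ℝ × ℝ) → ℝ × ℝ → ℝ) (μ : Measure (ℝ × ℝ)) (z : ℝ × ℝ) : ℝ :=
  deriv (fun x => Fx F μ (x, z.2)) z.1

/-- Partial derivative `∂_ω F[μ](x,ω)`. -/
def Fw (F : Measure (ℝ × ℝ) → ℝ × ℝ → ℝ) (μ : Measure (ℝ × ℝ)) (z : ℝ × ℝ) : ℝ :=
  deriv (fun w => F μ (z.1, w)) z.2

/-- The spatial average (barycenter) `x_c[μ] = ∫ x μ(dx,dω)`. -/
def xc (μ : Measure (ℝ × ℝ)) : ℝ := ∫ z, z.1 ∂μ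

/-- The mean frequency `ω_c = ∫ ω ν(dω)`. -/
def wc (ν : Measure ℝ) : ℝ := ∫ ω, ω ∂ν

/-- The measure `δ_x ⊗ ν`. -/
def diracProd (x : ℝ) (ν : Measure ℝ) : Measure (ℝ × ℝ) := (Measure.dirac x).prod ν

/-- `P₂^ν(ℝ²)`: probability measures on `ℝ²` with finite second moment and
`ω`-marginal `ν`. -/
def P2nu (ν : Measure ℝ) : Set (Measure (ℝ × ℝ)) :=
  {μ | IsProbabilityMeasure μ ∧ Integrable (fun z : ℝ × ℝ => z.1 ^ 2 + z.2 ^ 2) μ ∧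
    μ.map Prod.snd = ν}

/-- The diameter in `x` of the support of `μ`. -/
def diamx (μ : Measure (ℝ × ℝ)) : ℝ :=
  sSup {d : ℝ | ∃ z ∈ msupp μ, ∃ z' ∈ msupp μ, d = |z.1 - z'.1|}

/-- The structural assumptions `(A1)–(A5)` defining the class `F^ν_{A,B,I,M}(κ,γ)`. -/
structure Framework (ν : Measure ℝ) (F : Measure (ℝ × ℝ) → ℝ × ℝ → ℝ)
    (A B I M κ γ : ℝ) : Prop where
  /-- (A1) mean-field regularity -/
  hA1 : ∀ μ ∈ P2nu ν, ∀ μ' ∈ P2nu ν, ∀ x : ℝ, ∀ ω ∈ msupp ν,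
    |F μ (x, ω) - F μ' (x, ω)| ≤ κ * M * W1 μ μ' ∧
    |Fx F μ (x, ω) - Fx F μ' (x, ω)| ≤ κ * M * W1 μ μ'
  /-- (A2) space regularity -/
  hA2 : ∀ μ ∈ P2nu ν, ContDiff ℝ 2 (F μ) ∧
    (∀ z : ℝ × ℝ, |Fx F μ z| ≤ κ * I) ∧ (∀ z : ℝ × ℝ, |Fxx F μ z| ≤ κ * I) ∧
    (∀ z : ℝ × ℝ, |Fw F μ z| ≤ I)
  /-- (A3) lifted periodicity -/
  hA3 : ∀ μ ∈ P2nu ν, ∀ z : ℝ × ℝ,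
    F (μ.map fun w : ℝ × ℝ => (w.1 + 2 * π, w.2)) (z.1 + 2 * π, z.2) = F μ z
  /-- (A4) no stationarity -/
  hA4 : ∀ x : ℝ, A ≤ F (diracProd x ν) (x, wc ν)
  /-- (A5) synchronization -/
  hA5 : (∫ x in (0:ℝ)..(2 * π),
      Fx F (diracProd x ν) (x, wc ν) / F (diracProd x ν) (x, wc ν)) ≤ -(κ * B)

/-- `μ` is a measure-valued solution of the nonlocal continuity equation
`∂ₜ μ + ∂ₓ (F[μ] μ) = 0` on `[0,∞)`. -/
def IsSol (F : Measure (ℝ × ℝ) → ℝ × ℝ → ℝ) (μ : ℝ → Measure (ℝ × ℝ)) : Prop :=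
  (∀ φ : ℝ × ℝ → ℝ, Continuous φ → HasCompactSupport φ →
    ContinuousOn (fun t => ∫ z, φ z ∂(μ t)) (Ici 0)) ∧
  (∀ φ : ℝ → ℝ × ℝ → ℝ,
    ContDiff ℝ 1 (fun q : ℝ × (ℝ × ℝ) => φ q.1 q.2) →
    HasCompactSupport (fun q : ℝ × (ℝ × ℝ) => φ q.1 q.2) →
    ∀ t : ℝ, 0 ≤ t →
      ∫ z, φ t z ∂(μ t) = (∫ z, φ 0 z ∂(μ 0)) +
        ∫ s in (0:ℝ)..t, ∫ z, (deriv (fun u => φ u z) s +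
          F (μ s) z * deriv (fun x => φ s (x, z.2)) z.1) ∂(μ s))

/-- `X` is the characteristic flow associated with a solution `μ`:
`dX/dt = F[μ_t](X(t,x,ω),ω)`, `X(0,x,ω) = x`. -/
def IsFlow (F : Measure (ℝ × ℝ) → ℝ × ℝ → ℝ) (μ : ℝ → Measure (ℝ × ℝ))
    (X : ℝ → ℝ → ℝ → ℝ) : Prop :=
  (∀ x ω : ℝ, X 0 x ω = x) ∧
  ∀ x ω t : ℝ, 0 ≤ t → HasDerivAt (fun τ => X τ x ω) (F (μ t) (X t x ω, ω)) t

/-- `K` is a disintegration of `μ` with respect to the `ω`-marginal `ν`. -/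
def IsDisint (ν : Measure ℝ) (μ : Measure (ℝ × ℝ)) (K : ℝ → Measure ℝ) : Prop :=
  (∀ ω, IsProbabilityMeasure (K ω)) ∧
  μ = ν.bind fun ω => (K ω).map fun x => (x, ω)

/-- The constant `C₁(κ,γ,D) = κ(M+I)D² + 2Iγ`. -/
def C1 (I M κ γ D : ℝ) : ℝ := κ * (M + I) * D ^ 2 + 2 * I * γ

/-- The constant `C₂(κ,γ,D)`. -/
def C2 (A I M κ γ D : ℝ) : ℝ :=
  C1 I M κ γ D / A +
    (((κ + 1) * I + κ * M) * D + I * γ) * (κ * I * D + C1 I M κ γ D) /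
      (A * (A - ((κ + 1) * I + κ * M) * D - I * γ))

/-- The constant `E₁(κ,γ,D) = κ (D (3I/2 + M) + Iγ)`. -/
def E1 (I M κ γ D : ℝ) : ℝ := κ * (D * (3 * I / 2 + M) + I * γ)

/-- The constant `E₂(κ,γ,D)`. -/
def E2 (A I M κ γ D : ℝ) : ℝ :=
  κ / (A - ((κ + 1) * I + κ * M) * D - I * γ) *
    (D * (3 * I / 2 + M) + I * γ + I * (κ * (I + M) * D + I * γ) / A)

/-- Membership in `C_ν^{(1)}(Δ)`. -/
def MemC1 (ν : Measure ℝ) (Δ : ℝ → ℝ) (μ : Measure (ℝ × ℝ)) : Prop :=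
  μ ∈ P2nu ν ∧ diamx μ ≤ Δ (xc μ)

/-- Membership in `C_ν(Δ,Δ̃)`. -/
def MemC (ν : Measure ℝ) (Δ Δ' : ℝ → ℝ) (μ : Measure (ℝ × ℝ)) : Prop :=
  μ ∈ P2nu ν ∧ diamx μ ≤ Δ (xc μ) ∧
  ∃ K : ℝ → Measure ℝ, IsDisint ν μ K ∧
    ∀ ω ∈ msupp ν, ∀ ω' ∈ msupp ν, W2 (K ω) (K ω') ≤ Δ' (xc μ) * |ω - ω'|

/-- The metric `d₁` computed from disintegrations. -/
def d1k (ν : Measure ℝ) (K K' : ℝ → Measure ℝ) : ℝ := ∫ ω, W1 (K ω) (K' ω) ∂ν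

/-- The metric `d₂` computed from disintegrations. -/
def d2k (ν : Measure ℝ) (K K' : ℝ → Measure ℝ) : ℝ :=
  Real.sqrt (∫ ω, W2 (K ω) (K' ω) ^ 2 ∂ν)


lemma ae_mem_msupp (ν : Measure ℝ) : ∀ᵐ ω ∂ν, ω ∈ msupp ν := by
  filter_upwards [Measure.support_mem_ae (μ := ν)] with ω hω U hU hmem
  exact ((Measure.mem_support_iff_forall ω).1 hω U (hU.mem_nhds hmem)).ne'

section Wasserstein

variable {μ μ' : Measure (ℝ × ℝ)}

lemma W1_nonneg : 0 ≤ W1 μ μ' :=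
  Real.iInf_nonneg fun _ => integral_nonneg fun _ => dist_nonneg

lemma W1_le_integral {pl : Measure ((ℝ × ℝ) × (ℝ × ℝ))} (h : IsCoupling pl μ μ') :
    W1 μ μ' ≤ ∫ q, dist q.1 q.2 ∂pl :=
  ciInf_le (f := fun pl : {pl : Measure ((ℝ × ℝ) × (ℝ × ℝ)) // IsCoupling pl μ μ'} =>
      ∫ q, dist q.1 q.2 ∂(pl.1))
    ⟨0, by rintro _ ⟨p, rfl⟩; exact integral_nonneg fun _ => dist_nonneg⟩ ⟨pl, h⟩

lemma isCoupling_prod [IsProbabilityMeasure μ] [IsProbabilityMeasure μ'] :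
    IsCoupling (μ.prod μ') μ μ' := by
  constructor
  · simp [Measure.map_fst_prod]
  · simp [Measure.map_snd_prod]

lemma le_W1 [IsProbabilityMeasure μ] [IsProbabilityMeasure μ'] {c : ℝ}
    (h : ∀ pl : Measure ((ℝ × ℝ) × (ℝ × ℝ)), IsCoupling pl μ μ' → c ≤ ∫ q, dist q.1 q.2 ∂pl) :
    c ≤ W1 μ μ' := by
  have : Nonempty {pl : Measure ((ℝ × ℝ) × (ℝ × ℝ)) // IsCoupling pl μ μ'} :=
    ⟨⟨_, isCoupling_prod⟩⟩
  exact le_ciInf fun pl => h pl.1 pl.2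

lemma IsCoupling.integrable_fst {pl : Measure ((ℝ × ℝ) × (ℝ × ℝ))} (h : IsCoupling pl μ μ')
    {f : ℝ × ℝ → ℝ} (hf : Integrable f μ) : Integrable (fun q => f q.1) pl := by
  rw [← h.1] at hf
  exact hf.comp_measurable measurable_fst

lemma IsCoupling.integrable_snd {pl : Measure ((ℝ × ℝ) × (ℝ × ℝ))} (h : IsCoupling pl μ μ')
    {f : ℝ × ℝ → ℝ} (hf : Integrable f μ') : Integrable (fun q => f q.2) pl := by
  rw [← h.2] at hf
  exact hf.comp_measurable measurable_snd

lemma IsCoupling.integral_fst {pl : Measure ((ℝ × ℝ) × (ℝ × ℝ))} (h : IsCoupling pl μ μ')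
    {f : ℝ × ℝ → ℝ} (hf : Integrable f μ) : ∫ q, f q.1 ∂pl = ∫ z, f z ∂μ := by
  have hf' := hf.aestronglyMeasurable
  rw [← h.1] at hf'
  rw [← integral_map measurable_fst.aemeasurable hf', h.1]

lemma IsCoupling.integral_snd {pl : Measure ((ℝ × ℝ) × (ℝ × ℝ))} (h : IsCoupling pl μ μ')
    {f : ℝ × ℝ → ℝ} (hf : Integrable f μ') : ∫ q, f q.2 ∂pl = ∫ z, f z ∂μ' := by
  have hf' := hf.aestronglyMeasurable
  rw [← h.2] at hf'
  rw [← integral_map measurable_snd.aemeasurable hf', h.2]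

lemma dist_le_add_norm_norm (z w : ℝ × ℝ) : dist z w ≤ ‖z‖ + ‖w‖ := by
  rw [dist_eq_norm]; exact norm_sub_le z w

lemma IsCoupling.integrable_dist {pl : Measure ((ℝ × ℝ) × (ℝ × ℝ))} (h : IsCoupling pl μ μ')
    (hμ : Integrable (fun z => ‖z‖) μ) (hμ' : Integrable (fun z => ‖z‖) μ') :
    Integrable (fun q => dist q.1 q.2) pl := by
  refine ((h.integrable_fst hμ).add (h.integrable_snd hμ')).mono'
    (by fun_prop) (Eventually.of_forall fun q => ?_)
  rw [Real.norm_of_nonneg dist_nonneg]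
  exact dist_le_add_norm_norm _ _

lemma abs_integral_sub_le_W1 [IsProbabilityMeasure μ] [IsProbabilityMeasure μ'] {f : ℝ × ℝ → ℝ}
    {Lc : ℝ} (hL : 0 < Lc) (hf : ∀ z z', |f z - f z'| ≤ Lc * dist z z')
    (hi : Integrable f μ) (hi' : Integrable f μ')
    (hμ : Integrable (fun z => ‖z‖) μ) (hμ' : Integrable (fun z => ‖z‖) μ') :
    |∫ z, f z ∂μ - ∫ z, f z ∂μ'| ≤ Lc * W1 μ μ' := by
  rw [mul_comm, ← div_le_iff₀ hL]
  refine le_W1 fun pl h => ?_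
  rw [div_le_iff₀ hL, mul_comm, ← integral_const_mul, ← h.integral_fst hi, ← h.integral_snd hi',
    ← integral_sub (h.integrable_fst hi) (h.integrable_snd hi')]
  refine (abs_integral_le_integral_abs).trans (integral_mono ?_ ?_ fun q => hf q.1 q.2)
  · exact ((h.integrable_fst hi).sub (h.integrable_snd hi')).abs
  · exact (h.integrable_dist hμ hμ').const_mul _

lemma W1_le_add [IsProbabilityMeasure μ] [IsProbabilityMeasure μ']
    (hμ : Integrable (fun z => ‖z‖) μ) (hμ' : Integrable (fun z => ‖z‖) μ') :
    W1 μ μ' ≤ ∫ z, ‖z‖ ∂μ + ∫ z, ‖z‖ ∂μ' := by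
  have h : IsCoupling (μ.prod μ') μ μ' := isCoupling_prod
  refine (W1_le_integral h).trans ?_
  rw [← h.integral_fst hμ, ← h.integral_snd hμ',
    ← integral_add (h.integrable_fst hμ) (h.integrable_snd hμ')]
  exact integral_mono (h.integrable_dist hμ hμ')
    ((h.integrable_fst hμ).add (h.integrable_snd hμ')) fun q => dist_le_add_norm_norm _ _

lemma isCoupling_withDensity [IsProbabilityMeasure μ] [IsProbabilityMeasure μ']
    {g : (ℝ × ℝ) × (ℝ × ℝ) → ENNReal} (hg : Measurable g)
    (h1 : ∀ᵐ z ∂μ, ∫⁻ w, g (z, w) ∂μ' = 1) (h2 : ∀ᵐ w ∂μ', ∫⁻ z, g (z, w) ∂μ = 1) :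
    IsCoupling ((μ.prod μ').withDensity g) μ μ' := by
  constructor
  · ext s hs
    rw [Measure.map_apply measurable_fst hs, withDensity_apply _ (measurable_fst hs),
      ← lintegral_indicator (measurable_fst hs),
      lintegral_prod _ ((hg.indicator (measurable_fst hs)).aemeasurable)]
    have : ∀ᵐ z ∂μ, ∫⁻ w, (Prod.fst ⁻¹' s).indicator g (z, w) ∂μ' = s.indicator 1 z := by
      filter_upwards [h1] with z hz
      by_cases hzs : z ∈ s
      · simp [hzs, Set.indicator, hz]
      · simp [hzs, Set.indicator]
    rw [lintegral_congr_ae this, lintegral_indicator_one hs]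
  · ext s hs
    rw [Measure.map_apply measurable_snd hs, withDensity_apply _ (measurable_snd hs),
      ← lintegral_indicator (measurable_snd hs),
      lintegral_prod_symm _ ((hg.indicator (measurable_snd hs)).aemeasurable)]
    have : ∀ᵐ w ∂μ', ∫⁻ z, (Prod.snd ⁻¹' s).indicator g (z, w) ∂μ = s.indicator 1 w := by
      filter_upwards [h2] with z hz
      by_cases hzs : z ∈ s
      · simp [hzs, Set.indicator, hz]
      · simp [hzs, Set.indicator]
    rw [lintegral_congr_ae this, lintegral_indicator_one hs]

end Wasserstein

section Partition

variable {μ μ' : Measure (ℝ × ℝ)}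

/-- A marginal of the coupling density built from a partition into small pieces. -/
lemma lintegral_partition_density [IsProbabilityMeasure μ] [IsProbabilityMeasure μ'] {n : ℕ}
    {ρ : Fin n → ℝ × ℝ → ℝ} {k c : Fin n → ℝ} {r : ℝ} {σ σ' : ℝ × ℝ → ℝ}
    (hρ0 : ∀ i z, 0 ≤ ρ i z) (hk0 : ∀ i, 0 ≤ k i) (hr : 0 ≤ r)
    (hσ0 : ∀ z, 0 ≤ σ z) (hσ'0 : ∀ z, 0 ≤ σ' z)
    (hρi : ∀ i, Integrable (ρ i) μ') (hσi : Integrable σ μ) (hσ'i : Integrable σ' μ')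
    (hk : ∀ i, k i * ∫ w, ρ i w ∂μ' = c i) (hσ : ∀ z, σ z = 1 - ∑ i, c i * ρ i z)
    (hσr : ∫ z, σ z ∂μ = r) (hσ'r : ∫ w, σ' w ∂μ' = r) :
    ∀ᵐ z ∂μ, ∫⁻ w, ENNReal.ofReal (∑ i, k i * (ρ i z * ρ i w) + σ z * σ' w / r) ∂μ' = 1 := by
  have hσz : ∀ᵐ z ∂μ, r = 0 → σ z = 0 := by
    by_cases h : r = 0
    · rw [h] at hσr
      filter_upwards [(integral_eq_zero_iff_of_nonneg hσ0 hσi).1 hσr] with z hz _ using hz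
    · exact Eventually.of_forall fun z h' => absurd h' h
  filter_upwards [hσz] with z hz
  have hi1 : Integrable (fun w => ∑ i, k i * (ρ i z * ρ i w)) μ' :=
    integrable_finsetSum _ fun i _ => ((hρi i).const_mul _).const_mul _
  have hi2 : Integrable (fun w => σ z * σ' w / r) μ' := (hσ'i.const_mul _).div_const _
  rw [← ofReal_integral_eq_lintegral_ofReal
      (f := fun w => ∑ i, k i * (ρ i z * ρ i w) + σ z * σ' w / r) (hi1.add hi2),
    integral_add hi1 hi2,
    integral_finsetSum _ fun i _ => ((hρi i).const_mul _).const_mul _, ENNReal.ofReal_eq_one]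
  · have : ∀ i, ∫ w, k i * (ρ i z * ρ i w) ∂μ' = c i * ρ i z := fun i => by
      rw [integral_const_mul, integral_const_mul, ← hk i]; ring
    rw [Finset.sum_congr rfl fun i _ => this i, integral_div, integral_const_mul, hσ'r]
    by_cases h : r = 0
    · have := hσ z
      rw [hz h] at this
      rw [hz h, zero_mul, zero_div, add_zero]; linarith
    · rw [mul_div_assoc, div_self h, hσ z]; ring
  · refine Eventually.of_forall fun w => ?_
    exact add_nonneg (Finset.sum_nonneg fun i _ => mul_nonneg (hk0 i)
      (mul_nonneg (hρ0 i z) (hρ0 i w))) (div_nonneg (mul_nonneg (hσ0 z) (hσ'0 w)) hr)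

lemma W1_le_partition [IsProbabilityMeasure μ] [IsProbabilityMeasure μ'] {n : ℕ}
    {ρ : Fin n → ℝ × ℝ → ℝ} (hc : ∀ i, Continuous (ρ i)) (hρ0 : ∀ i z, 0 ≤ ρ i z)
    (hρ1 : ∀ z, ∑ i, ρ i z ≤ 1) {ε : ℝ} (hε : 0 ≤ ε)
    (hd : ∀ i z w, ρ i z ≠ 0 → ρ i w ≠ 0 → dist z w ≤ ε) {K lam : ℝ} (hlam : 0 < lam)
    (hi : Integrable (fun z => ‖z‖ ^ 2) μ) (hi' : Integrable (fun z => ‖z‖ ^ 2) μ')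
    (hK : ∫ z, ‖z‖ ^ 2 ∂μ ≤ K) (hK' : ∫ z, ‖z‖ ^ 2 ∂μ' ≤ K) :
    W1 μ μ' ≤ ε + 2 * (lam * (1 - ∑ i, min (∫ z, ρ i z ∂μ) (∫ z, ρ i z ∂μ')) + K / lam) := by
  have hρle : ∀ i z, ρ i z ≤ 1 := fun i z =>
    (Finset.single_le_sum (f := fun i => ρ i z) (fun j _ => hρ0 j z) (Finset.mem_univ i)).trans
      (hρ1 z)
  have bdd : ∀ (m : Measure (ℝ × ℝ)) [IsProbabilityMeasure m] (f : ℝ × ℝ → ℝ), Continuous f →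
      (∀ z, 0 ≤ f z) → (∀ z, f z ≤ 1) → Integrable f m := fun m _ f hf h0 h1 =>
    Integrable.of_bound hf.aestronglyMeasurable 1
      (Eventually.of_forall fun z => by rw [Real.norm_of_nonneg (h0 z)]; exact h1 z)
  set α : Fin n → ℝ := fun i => ∫ z, ρ i z ∂μ with hα
  set β : Fin n → ℝ := fun i => ∫ z, ρ i z ∂μ' with hβ
  have hα0 : ∀ i, 0 ≤ α i := fun i => integral_nonneg (hρ0 i)
  have hβ0 : ∀ i, 0 ≤ β i := fun i => integral_nonneg (hρ0 i)
  set m : Fin n → ℝ := fun i => min (α i) (β i) with hm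
  have hm0 : ∀ i, 0 ≤ m i := fun i => le_min (hα0 i) (hβ0 i)
  have hmα : ∀ i, α i = 0 → m i = 0 := fun i h =>
    le_antisymm ((min_le_left _ _).trans h.le) (hm0 i)
  have hmβ : ∀ i, β i = 0 → m i = 0 := fun i h =>
    le_antisymm ((min_le_right _ _).trans h.le) (hm0 i)
  set c : Fin n → ℝ := fun i => m i / α i with hcdef
  set d : Fin n → ℝ := fun i => m i / β i with hddef
  set k : Fin n → ℝ := fun i => m i / (α i * β i) with hkdef
  have hk0 : ∀ i, 0 ≤ k i := fun i => div_nonneg (hm0 i) (mul_nonneg (hα0 i) (hβ0 i))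
  have hkβ : ∀ i, k i * β i = c i := fun i => by
    by_cases h : β i = 0
    · simp [hkdef, hcdef, h, hmβ i h]
    · simp only [hkdef, hcdef]
      rw [div_mul_eq_mul_div, mul_div_mul_right _ _ h]
  have hkα : ∀ i, k i * α i = d i := fun i => by
    by_cases h : α i = 0
    · simp [hkdef, hddef, h, hmα i h]
    · simp only [hkdef, hddef]
      rw [div_mul_eq_mul_div, mul_comm (m i), mul_div_mul_left _ _ h]
  have hcα : ∀ i, c i * α i = m i := fun i => by
    by_cases h : α i = 0
    · simp [h, hmα i h]
    · simp only [hcdef]; field_simp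
  have hdβ : ∀ i, d i * β i = m i := fun i => by
    by_cases h : β i = 0
    · simp [h, hmβ i h]
    · simp only [hddef]; field_simp
  have hc0 : ∀ i, 0 ≤ c i := fun i => div_nonneg (hm0 i) (hα0 i)
  have hd0 : ∀ i, 0 ≤ d i := fun i => div_nonneg (hm0 i) (hβ0 i)
  have hc1 : ∀ i, c i ≤ 1 := fun i => div_le_one_of_le₀ (min_le_left _ _) (hα0 i)
  have hd1 : ∀ i, d i ≤ 1 := fun i => div_le_one_of_le₀ (min_le_right _ _) (hβ0 i)
  set σ : ℝ × ℝ → ℝ := fun z => 1 - ∑ i, c i * ρ i z with hσ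
  set σ' : ℝ × ℝ → ℝ := fun z => 1 - ∑ i, d i * ρ i z with hσ'
  have hσ0 : ∀ z, 0 ≤ σ z := fun z => by
    have : ∑ i, c i * ρ i z ≤ ∑ i, ρ i z :=
      Finset.sum_le_sum fun i _ => mul_le_of_le_one_left (hρ0 i z) (hc1 i)
    simp only [hσ]; linarith [hρ1 z]
  have hσ'0 : ∀ z, 0 ≤ σ' z := fun z => by
    have : ∑ i, d i * ρ i z ≤ ∑ i, ρ i z :=
      Finset.sum_le_sum fun i _ => mul_le_of_le_one_left (hρ0 i z) (hd1 i)
    simp only [hσ']; linarith [hρ1 z]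
  have hσ1 : ∀ z, σ z ≤ 1 := fun z => by
    have : 0 ≤ ∑ i, c i * ρ i z := Finset.sum_nonneg fun i _ => mul_nonneg (hc0 i) (hρ0 i z)
    simp only [hσ]; linarith
  have hσ'1 : ∀ z, σ' z ≤ 1 := fun z => by
    have : 0 ≤ ∑ i, d i * ρ i z := Finset.sum_nonneg fun i _ => mul_nonneg (hd0 i) (hρ0 i z)
    simp only [hσ']; linarith
  have hσc : Continuous σ := by fun_prop
  have hσ'c : Continuous σ' := by fun_prop
  have hσi := bdd μ σ hσc hσ0 hσ1
  have hσ'i := bdd μ' σ' hσ'c hσ'0 hσ'1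
  have hρi := fun i => bdd μ (ρ i) (hc i) (hρ0 i) (hρle i)
  have hρi' := fun i => bdd μ' (ρ i) (hc i) (hρ0 i) (hρle i)
  set r : ℝ := 1 - ∑ i, m i with hr
  have hσr : ∫ z, σ z ∂μ = r := by
    simp only [hσ]
    rw [integral_sub (integrable_const _) (integrable_finsetSum _ fun i _ => (hρi i).const_mul _),
      integral_finsetSum _ fun i _ => (hρi i).const_mul _]
    simp only [integral_const_mul, hr]
    rw [Finset.sum_congr rfl fun i _ => hcα i]; simp
  have hσ'r : ∫ z, σ' z ∂μ' = r := by
    simp only [hσ']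
    rw [integral_sub (integrable_const _) (integrable_finsetSum _ fun i _ => (hρi' i).const_mul _),
      integral_finsetSum _ fun i _ => (hρi' i).const_mul _]
    simp only [integral_const_mul, hr]
    rw [Finset.sum_congr rfl fun i _ => hdβ i]; simp
  have hr0 : 0 ≤ r := hσr ▸ integral_nonneg hσ0
  set G : (ℝ × ℝ) × (ℝ × ℝ) → ℝ := fun q =>
    ∑ i, k i * (ρ i q.1 * ρ i q.2) + σ q.1 * σ' q.2 / r with hG
  have hG0 : ∀ q, 0 ≤ G q := fun q => add_nonneg (Finset.sum_nonneg fun i _ => mul_nonneg (hk0 i)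
      (mul_nonneg (hρ0 i _) (hρ0 i _))) (div_nonneg (mul_nonneg (hσ0 _) (hσ'0 _)) hr0)
  have hGc : Continuous G := by fun_prop
  have hcoup : IsCoupling ((μ.prod μ').withDensity fun q => ENNReal.ofReal (G q)) μ μ' := by
    refine isCoupling_withDensity (by fun_prop) ?_ ?_
    · exact lintegral_partition_density hρ0 hk0 hr0 hσ0 hσ'0 hρi' hσi hσ'i hkβ (fun _ => rfl)
        hσr hσ'r
    · refine (lintegral_partition_density hρ0 hk0 hr0 hσ'0 hσ0 hρi hσ'i hσi hkα (fun _ => rfl)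
        hσ'r hσr).mono fun w hw => ?_
      rw [← hw]
      refine lintegral_congr fun z => ?_
      simp only [hG]
      congr 2
      · exact Finset.sum_congr rfl fun i _ => by ring
      · ring
  have hnσ : ∀ (m : Measure (ℝ × ℝ)) [IsProbabilityMeasure m] (f : ℝ × ℝ → ℝ), Continuous f →
      (∀ z, 0 ≤ f z) → (∀ z, f z ≤ 1) → Integrable (fun z => ‖z‖ ^ 2) m →
      ∫ z, ‖z‖ ^ 2 ∂m ≤ K → ∫ z, f z ∂m = r →
      Integrable (fun z => ‖z‖ * f z) m ∧ ∫ z, ‖z‖ * f z ∂m ≤ lam * r + K / lam := by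
    intro m _ f hf h0 h1 hi hK hfr
    have hfi := bdd m f hf h0 h1
    have hpt : ∀ z, ‖z‖ * f z ≤ lam * f z + ‖z‖ ^ 2 / lam := fun z => by
      have h2 : 0 ≤ ‖z‖ ^ 2 / lam := by positivity
      rcases le_total ‖z‖ lam with h | h
      · linarith [mul_le_mul_of_nonneg_right h (h0 z)]
      · have h3 : ‖z‖ ≤ ‖z‖ ^ 2 / lam := by
          rw [le_div_iff₀ hlam]; nlinarith [norm_nonneg z]
        have h4 : ‖z‖ * f z ≤ ‖z‖ := mul_le_of_le_one_right (norm_nonneg z) (h1 z)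
        have h5 : 0 ≤ lam * f z := mul_nonneg hlam.le (h0 z)
        linarith
    have hI := (hfi.const_mul lam).add (hi.div_const lam)
    have hI1 : Integrable (fun z => ‖z‖ * f z) m := by
      refine hI.mono' (by fun_prop) (Eventually.of_forall fun z => ?_)
      rw [Real.norm_of_nonneg (mul_nonneg (norm_nonneg z) (h0 z))]
      exact hpt z
    refine ⟨hI1, (integral_mono hI1 hI hpt).trans ?_⟩
    simp only [Pi.add_apply]
    rw [integral_add (hfi.const_mul lam) (hi.div_const lam), integral_const_mul, hfr, integral_div]
    gcongr
  obtain ⟨hn1, hn2⟩ := hnσ μ σ hσc hσ0 hσ1 hi hK hσr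
  obtain ⟨hn1', hn2'⟩ := hnσ μ' σ' hσ'c hσ'0 hσ'1 hi' hK' hσ'r
  refine (W1_le_integral hcoup).trans ?_
  rw [integral_withDensity_eq_integral_toReal_smul (by fun_prop)
    (Eventually.of_forall fun _ => ENNReal.ofReal_lt_top)]
  have hb1 : ∀ i, Integrable (fun q : (ℝ × ℝ) × (ℝ × ℝ) => ρ i q.1 * ρ i q.2) (μ.prod μ') :=
    fun i => (hρi i).mul_prod (hρi' i)
  have hb2 : Integrable (fun q : (ℝ × ℝ) × (ℝ × ℝ) => (‖q.1‖ * σ q.1) * σ' q.2) (μ.prod μ') :=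
    hn1.mul_prod hσ'i
  have hb3 : Integrable (fun q : (ℝ × ℝ) × (ℝ × ℝ) => σ q.1 * (‖q.2‖ * σ' q.2)) (μ.prod μ') :=
    hσi.mul_prod hn1'
  have hb5 : Integrable (fun q : (ℝ × ℝ) × (ℝ × ℝ) =>
      (‖q.1‖ * σ q.1) * σ' q.2 + σ q.1 * (‖q.2‖ * σ' q.2)) (μ.prod μ') := hb2.add hb3
  have hb4 := (integrable_finsetSum Finset.univ fun i (_ : i ∈ Finset.univ) =>
    (hb1 i).const_mul (ε * k i)).add
    (hb5.div_const r)
  refine (integral_mono_of_nonneg (Eventually.of_forall fun q => smul_nonneg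
    ENNReal.toReal_nonneg dist_nonneg) hb4 (Eventually.of_forall fun q => ?_)).trans ?_
  · simp only [Pi.add_apply, smul_eq_mul]
    rw [ENNReal.toReal_ofReal (hG0 q)]
    simp only [hG]
    rw [add_mul, Finset.sum_mul]
    refine add_le_add (Finset.sum_le_sum fun i _ => ?_) ?_
    · by_cases h1 : ρ i q.1 = 0
      · simp [h1]
      by_cases h2 : ρ i q.2 = 0
      · simp [h2]
      have := hd i _ _ h1 h2
      have h3 : 0 ≤ k i * (ρ i q.1 * ρ i q.2) :=
        mul_nonneg (hk0 i) (mul_nonneg (hρ0 i _) (hρ0 i _))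
      nlinarith
    · rw [div_mul_eq_mul_div]
      gcongr
      have h1 := dist_le_add_norm_norm q.1 q.2
      have h2 : 0 ≤ σ q.1 * σ' q.2 := mul_nonneg (hσ0 _) (hσ'0 _)
      nlinarith
  · simp only [Pi.add_apply]
    rw [integral_add (integrable_finsetSum Finset.univ fun i _ => (hb1 i).const_mul (ε * k i))
      (hb5.div_const r), integral_finsetSum _ fun i _ => (hb1 i).const_mul (ε * k i),
      integral_div, integral_add hb2 hb3, integral_prod_mul (fun z => ‖z‖ * σ z) σ',
      integral_prod_mul σ (fun z => ‖z‖ * σ' z), hσr, hσ'r]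
    have h1 : ∀ i, ∫ q : (ℝ × ℝ) × (ℝ × ℝ), ε * k i * (ρ i q.1 * ρ i q.2) ∂(μ.prod μ')
        = ε * m i := fun i => by
      rw [integral_const_mul, integral_prod_mul]
      change ε * k i * (α i * β i) = _
      rw [← hdβ i, ← hkα i]; ring
    rw [Finset.sum_congr rfl fun i _ => h1 i, ← Finset.mul_sum]
    have h2 : ε * ∑ i, m i ≤ ε := mul_le_of_le_one_right hε (by linarith)
    have h3 : ((∫ z, ‖z‖ * σ z ∂μ) * r + r * ∫ z, ‖z‖ * σ' z ∂μ') / r ≤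
        (∫ z, ‖z‖ * σ z ∂μ) + ∫ z, ‖z‖ * σ' z ∂μ' := by
      by_cases h : r = 0
      · rw [h, div_zero]
        exact add_nonneg (integral_nonneg fun z => mul_nonneg (norm_nonneg z) (hσ0 z))
          (integral_nonneg fun z => mul_nonneg (norm_nonneg z) (hσ'0 z))
      · rw [mul_comm r, ← add_mul, mul_div_assoc, div_self h, mul_one]
    linarith

end Partition

section Narrow

open Topology

variable {μ : ℝ → Measure (ℝ × ℝ)} {S : Set ℝ} {t : ℝ}

lemma exists_cutoff (m : Measure (ℝ × ℝ)) [IsProbabilityMeasure m] {δ : ℝ} (hδ : 0 < δ) :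
    ∃ χ : ℝ × ℝ → ℝ, Continuous χ ∧ HasCompactSupport χ ∧ (∀ z, 0 ≤ χ z) ∧ (∀ z, χ z ≤ 1) ∧
      1 - δ < ∫ z, χ z ∂m := by
  set χ : ℕ → ℝ × ℝ → ℝ := fun n z => max 0 (1 - ‖z‖ / (n + 1)) with hχ
  have h0 : ∀ n z, 0 ≤ χ n z := fun n z => le_max_left _ _
  have h1 : ∀ n z, χ n z ≤ 1 := fun n z => by
    refine max_le zero_le_one ?_
    have : 0 ≤ ‖z‖ / (n + 1) := by positivity
    linarith
  have hc : ∀ n, Continuous (χ n) := fun n => by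
    have : ∀ x : ℝ, (n : ℝ) + 1 ≠ 0 := fun _ => by positivity
    fun_prop
  have hlim : Tendsto (fun n => ∫ z, χ n z ∂m) atTop (𝓝 (∫ z, (1 : ℝ) ∂m)) := by
    refine tendsto_integral_of_dominated_convergence (fun _ => 1)
      (fun n => (hc n).aestronglyMeasurable) (integrable_const _)
      (fun n => Eventually.of_forall fun z => by rw [Real.norm_of_nonneg (h0 n z)]; exact h1 n z)
      (Eventually.of_forall fun z => ?_)
    have h : Tendsto (fun n : ℕ => 1 - ‖z‖ / ((n : ℝ) + 1)) atTop (𝓝 (1 - 0)) := by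
      refine tendsto_const_nhds.sub ?_
      exact tendsto_const_nhds.div_atTop
        (tendsto_natCast_atTop_atTop.atTop_add tendsto_const_nhds)
    have := (tendsto_const_nhds (x := (0 : ℝ))).max h
    simpa using this
  simp only [integral_const, probReal_univ, smul_eq_mul, mul_one] at hlim
  obtain ⟨n, hn⟩ := (hlim.eventually (lt_mem_nhds (by linarith : 1 - δ < 1))).exists
  refine ⟨χ n, hc n, ?_, h0 n, h1 n, hn⟩
  refine HasCompactSupport.of_support_subset_isCompact
    (isCompact_closedBall (0 : ℝ × ℝ) (n + 1)) fun z hz => ?_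
  rw [Metric.mem_closedBall, dist_zero_right]
  by_contra hlt
  push Not at hlt
  refine hz (max_eq_left ?_)
  have : 1 ≤ ‖z‖ / (n + 1) := by
    rw [le_div_iff₀ (by positivity)]; linarith
  linarith

lemma continuousWithinAt_integral_of_vague (ht : t ∈ S)
    (hp : ∀ s ∈ S, IsProbabilityMeasure (μ s))
    (hv : ∀ φ : ℝ × ℝ → ℝ, Continuous φ → HasCompactSupport φ →
      ContinuousWithinAt (fun s => ∫ z, φ z ∂(μ s)) S t)
    {f : ℝ × ℝ → ℝ} (hf : Continuous f) {C : ℝ} (hC : ∀ z, |f z| ≤ C) :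
    ContinuousWithinAt (fun s => ∫ z, f z ∂(μ s)) S t := by
  have hC0 : 0 ≤ C := (abs_nonneg _).trans (hC 0)
  rw [ContinuousWithinAt, Metric.tendsto_nhds]
  intro ε hε
  have := hp t ht
  obtain ⟨χ, hχc, hχs, hχ0, hχ1, hχ⟩ := exists_cutoff (μ t)
    (δ := ε / (2 * (C + 1))) (by positivity)
  have hlim : Tendsto (fun s => |∫ z, f z * χ z ∂(μ s) - ∫ z, f z * χ z ∂(μ t)|
      + (C * (1 - ∫ z, χ z ∂(μ s)) + C * (1 - ∫ z, χ z ∂(μ t)))) (𝓝[S] t)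
      (𝓝 (|∫ z, f z * χ z ∂(μ t) - ∫ z, f z * χ z ∂(μ t)|
      + (C * (1 - ∫ z, χ z ∂(μ t)) + C * (1 - ∫ z, χ z ∂(μ t))))) := by
    have h1 := hv (fun z => f z * χ z) (hf.mul hχc) hχs.mul_left
    have h2 := hv χ hχc hχs
    exact ((h1.sub tendsto_const_nhds).abs).add
      (((tendsto_const_nhds.sub h2).const_mul C).add tendsto_const_nhds)
  have hlt : |∫ z, f z * χ z ∂(μ t) - ∫ z, f z * χ z ∂(μ t)|
      + (C * (1 - ∫ z, χ z ∂(μ t)) + C * (1 - ∫ z, χ z ∂(μ t))) < ε := by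
    rw [sub_self, abs_zero, zero_add]
    have h3 : 1 - ∫ z, χ z ∂(μ t) < ε / (2 * (C + 1)) := by linarith
    rw [lt_div_iff₀ (by positivity)] at h3
    have h4 : ∫ z, χ z ∂(μ t) ≤ 1 := by
      have := integral_mono (μ := μ t) (hχc.integrable_of_hasCompactSupport hχs)
        (integrable_const (1 : ℝ)) hχ1
      simpa using this
    nlinarith
  filter_upwards [hlim.eventually (gt_mem_nhds hlt), self_mem_nhdsWithin] with s hs hsS
  have key : ∀ s ∈ S, |∫ z, f z ∂(μ s) - ∫ z, f z * χ z ∂(μ s)| ≤ C * (1 - ∫ z, χ z ∂(μ s)) := by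
    intro s hs
    have := hp s hs
    have i1 : Integrable f (μ s) := Integrable.of_bound hf.aestronglyMeasurable C
      (Eventually.of_forall hC)
    have i2 : Integrable χ (μ s) := hχc.integrable_of_hasCompactSupport hχs
    have i3 : Integrable (fun z => f z * χ z) (μ s) :=
      (hf.mul hχc).integrable_of_hasCompactSupport hχs.mul_left
    have h5 : C * (1 - ∫ z, χ z ∂(μ s)) = ∫ z, C * (1 - χ z) ∂(μ s) := by
      rw [integral_const_mul, integral_sub (integrable_const _) i2]; simp
    rw [← integral_sub i1 i3, h5]
    refine abs_integral_le_integral_abs.trans (integral_mono (i1.sub i3).abs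
      (((integrable_const _).sub i2).const_mul C) fun z => ?_)
    change |f z - f z * χ z| ≤ C * (1 - χ z)
    have h6 : f z - f z * χ z = f z * (1 - χ z) := by ring
    rw [h6, abs_mul, abs_of_nonneg (by linarith [hχ1 z] : 0 ≤ 1 - χ z)]
    exact mul_le_mul_of_nonneg_right (hC z) (by linarith [hχ1 z])
  rw [Real.dist_eq]
  refine lt_of_le_of_lt ?_ hs
  have k1 := abs_le.1 (key s hsS)
  have k2 := abs_le.1 (key t ht)
  have k3 := abs_le.1 (le_refl |∫ z, f z * χ z ∂(μ s) - ∫ z, f z * χ z ∂(μ t)|)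
  rw [abs_le]
  constructor <;> linarith [k1.1, k1.2, k2.1, k2.2, k3.1, k3.2]

lemma tendsto_W1_of_vague (ht : t ∈ S) (hp : ∀ s ∈ S, IsProbabilityMeasure (μ s)) {K : ℝ}
    (hi : ∀ s ∈ S, Integrable (fun z => ‖z‖ ^ 2) (μ s)) (hK : ∀ s ∈ S, ∫ z, ‖z‖ ^ 2 ∂(μ s) ≤ K)
    (hv : ∀ φ : ℝ × ℝ → ℝ, Continuous φ → HasCompactSupport φ →
      ContinuousWithinAt (fun s => ∫ z, φ z ∂(μ s)) S t) :
    Tendsto (fun s => W1 (μ s) (μ t)) (𝓝[S] t) (𝓝 0) := by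
  have hK0 : 0 ≤ K := (integral_nonneg fun z => by positivity).trans (hK t ht)
  have hpt := hp t ht
  rw [Metric.tendsto_nhds]
  intro ε hε
  set lam : ℝ := 8 * (K + 1) / ε with hlam
  have hlam0 : 0 < lam := by positivity
  set δ : ℝ := ε / (8 * lam) with hδ
  have hδ0 : 0 < δ := by positivity
  obtain ⟨R, hR0, hR⟩ : ∃ R : ℝ, 0 < R ∧ K / R < δ :=
    ⟨(K + 1) / δ, by positivity, by rw [div_div_eq_mul_div, div_lt_iff₀ (by positivity)]; nlinarith⟩
  have hcov : IsCompact {z : ℝ × ℝ | ‖z‖ ^ 2 ≤ R} := by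
    refine Metric.isCompact_of_isClosed_isBounded (isClosed_le (by fun_prop) continuous_const) ?_
    refine (Metric.isBounded_closedBall (x := (0 : ℝ × ℝ)) (r := R + 1)).subset fun z hz => ?_
    rw [Metric.mem_closedBall, dist_zero_right]
    have : ‖z‖ ^ 2 ≤ R := hz
    nlinarith [sq_nonneg (‖z‖ - 1)]
  obtain ⟨T, -, hTf, hT⟩ := hcov.finite_cover_balls (e := ε / 8) (by positivity)
  let e := hTf.toFinset.equivFin
  obtain ⟨f, hfs, hf1, hf01, hfc⟩ := exists_continuous_sum_one_of_isOpen_isCompact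
    (s := fun i => Metric.ball ((e.symm i : hTf.toFinset) : ℝ × ℝ) (ε / 8))
    (fun i => Metric.isOpen_ball) hcov (fun z hz => by
      obtain ⟨y, hy, hzy⟩ := mem_iUnion₂.1 (hT hz)
      refine mem_iUnion.2 ⟨e ⟨y, hTf.mem_toFinset.2 hy⟩, ?_⟩
      simpa using hzy)
  set ρ := fun i z => f i z / max 1 (∑ j, f j z) with hρ
  have hmax : ∀ z, 0 < max 1 (∑ j, f j z) := fun z => lt_max_of_lt_left one_pos
  have hρc : ∀ i, Continuous (ρ i) := fun i => by
    refine Continuous.div (by fun_prop) (by fun_prop) fun z => (hmax z).ne'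
  have hρ0 : ∀ i z, 0 ≤ ρ i z := fun i z => div_nonneg (hf01 i z).1 (hmax z).le
  have hρ1 : ∀ z, ∑ i, ρ i z ≤ 1 := fun z => by
    simp only [hρ]
    rw [← Finset.sum_div, div_le_one (hmax z)]
    exact le_max_right _ _
  have hρcs : ∀ i, HasCompactSupport (ρ i) := fun i => by
    refine (hfc i).mono fun z hz => ?_
    intro h
    refine hz ?_
    simp [hρ, h]
  have hρd : ∀ i z w, ρ i z ≠ 0 → ρ i w ≠ 0 → dist z w ≤ ε / 4 := by
    have key : ∀ i z, ρ i z ≠ 0 → dist z ((e.symm i : hTf.toFinset) : ℝ × ℝ) < ε / 8 := by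
      intro i z h
      have : f i z ≠ 0 := fun h0 => h (by simp [hρ, h0])
      exact hfs i (subset_tsupport _ this)
    intro i z w hz hw
    have := dist_triangle_right z w ((e.symm i : hTf.toFinset) : ℝ × ℝ)
    linarith [key i z hz, key i w hw]
  have hsum : 1 - δ < ∑ i, ∫ z, ρ i z ∂(μ t) := by
    rw [← integral_finsetSum _ fun i _ => (hρc i).integrable_of_hasCompactSupport (hρcs i)]
    have h1 : 1 - K / R ≤ ∫ z, (1 - ‖z‖ ^ 2 / R) ∂(μ t) := by
      rw [integral_sub (integrable_const _) ((hi t ht).div_const _), integral_div]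
      have : (∫ z, ‖z‖ ^ 2 ∂(μ t)) / R ≤ K / R := by gcongr; exact hK t ht
      simp only [integral_const, probReal_univ, smul_eq_mul, mul_one]
      linarith
    have h2 : ∫ z, (1 - ‖z‖ ^ 2 / R) ∂(μ t) ≤ ∫ z, ∑ i, ρ i z ∂(μ t) := by
      refine integral_mono ((integrable_const _).sub ((hi t ht).div_const _))
        (integrable_finsetSum _ fun i _ => (hρc i).integrable_of_hasCompactSupport (hρcs i))
        fun z => ?_
      change 1 - ‖z‖ ^ 2 / R ≤ ∑ i, ρ i z
      by_cases hz : ‖z‖ ^ 2 ≤ R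
      · have h3 : ∑ j, f j z = 1 := by simpa using hf1 hz
        have h4 : ∑ i, ρ i z = 1 := by
          simp only [hρ]; rw [← Finset.sum_div, h3]; simp
        rw [h4]
        have : 0 ≤ ‖z‖ ^ 2 / R := by positivity
        linarith
      · have : 1 ≤ ‖z‖ ^ 2 / R := by
          rw [le_div_iff₀ hR0]; linarith
        linarith [Finset.sum_nonneg fun i (_ : i ∈ Finset.univ) => hρ0 i z]
    linarith
  have hlim : Tendsto (fun s => ∑ i, min (∫ z, ρ i z ∂(μ s)) (∫ z, ρ i z ∂(μ t))) (𝓝[S] t)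
      (𝓝 (∑ i, min (∫ z, ρ i z ∂(μ t)) (∫ z, ρ i z ∂(μ t)))) :=
    tendsto_finsetSum _ fun i _ => (hv (ρ i) (hρc i) (hρcs i)).min tendsto_const_nhds
  simp only [min_self] at hlim
  filter_upwards [hlim.eventually (lt_mem_nhds hsum), self_mem_nhdsWithin] with s hs hsS
  have := hp s hsS
  rw [Real.dist_eq, sub_zero, abs_of_nonneg W1_nonneg]
  refine (W1_le_partition hρc hρ0 hρ1 (by positivity : 0 ≤ ε / 4) hρd hlam0 (hi s hsS) (hi t ht)
    (hK s hsS) (hK t ht)).trans_lt ?_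
  have h1 : lam * (1 - ∑ i, min (∫ z, ρ i z ∂(μ s)) (∫ z, ρ i z ∂(μ t))) ≤ lam * δ := by
    gcongr; linarith
  have h2 : lam * δ = ε / 8 := by rw [hδ]; field_simp
  have h3 : K / lam ≤ ε / 8 := by
    rw [hlam, div_div_eq_mul_div, div_le_div_iff₀ (by positivity) (by positivity)]; nlinarith
  linarith

end Narrow

lemma Measure.ext_of_contDiff {μ μ' : Measure (ℝ × ℝ)} [IsProbabilityMeasure μ]
    [IsProbabilityMeasure μ']
    (h : ∀ ψ : ℝ × ℝ → ℝ, ContDiff ℝ 1 ψ → HasCompactSupport ψ → ∫ z, ψ z ∂μ = ∫ z, ψ z ∂μ') :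
    μ = μ' := by
  refine ext_of_generate_finite {U : Set (ℝ × ℝ) | IsOpen U ∧ Bornology.IsBounded U} ?_ ?_ ?_ ?_
  · have hb : TopologicalSpace.IsTopologicalBasis
        {U : Set (ℝ × ℝ) | IsOpen U ∧ Bornology.IsBounded U} := by
      refine TopologicalSpace.isTopologicalBasis_of_isOpen_of_nhds (fun U hU => hU.1)
        fun z U hz hU => ?_
      obtain ⟨r, hr, hrU⟩ := Metric.isOpen_iff.1 hU z hz
      exact ⟨Metric.ball z r, ⟨Metric.isOpen_ball, Metric.isBounded_ball⟩,
        Metric.mem_ball_self hr, hrU⟩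
    rw [← hb.borel_eq_generateFrom]
    exact BorelSpace.measurable_eq
  · intro U hU V hV _
    exact ⟨hU.1.inter hV.1, hU.2.subset inter_subset_left⟩
  · rintro U ⟨hU, hUb⟩
    obtain ⟨f, hfs, hfd, hfr⟩ := hU.exists_contDiff_support_eq (n := 1)
    have hf01 : ∀ z, f z ∈ Icc (0 : ℝ) 1 := fun z => hfr ⟨z, rfl⟩
    have hfc : HasCompactSupport f := by
      rw [HasCompactSupport, tsupport, hfs]
      exact hUb.isCompact_closure
    set g : ℕ → ℝ × ℝ → ℝ := fun n z => 1 - (1 - f z) ^ n with hg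
    have hgd : ∀ n, ContDiff ℝ 1 (g n) := fun n =>
      contDiff_const.sub ((contDiff_const.sub hfd).pow n)
    have hgc : ∀ n, HasCompactSupport (g n) := fun n => by
      refine hfc.mono fun z hz hz' => hz ?_
      simp [hg, hz']
    have hlim : ∀ (m : Measure (ℝ × ℝ)) [IsProbabilityMeasure m],
        Tendsto (fun n => ∫ z, g n z ∂m) atTop (nhds (m.real U)) := by
      intro m _
      rw [← integral_indicator_one hU.measurableSet]
      refine tendsto_integral_of_dominated_convergence (fun _ => 1)
        (fun n => (hgd n).continuous.aestronglyMeasurable) (integrable_const _)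
        (fun n => Eventually.of_forall fun z => ?_) (Eventually.of_forall fun z => ?_)
      · have h1 : 0 ≤ (1 - f z) ^ n := pow_nonneg (by linarith [(hf01 z).2]) n
        have h2 : (1 - f z) ^ n ≤ 1 := pow_le_one₀ (by linarith [(hf01 z).2])
          (by linarith [(hf01 z).1])
        rw [Real.norm_eq_abs, abs_le]
        constructor <;> simp only [hg] <;> linarith
      · by_cases hz : z ∈ U
        · have hz' : f z ≠ 0 := by rw [← Function.mem_support, hfs]; exact hz
          have h3 : 0 < f z := lt_of_le_of_ne (hf01 z).1 hz'.symm
          have := tendsto_pow_atTop_nhds_zero_of_lt_one (r := 1 - f z)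
            (by linarith [(hf01 z).2]) (by linarith)
          simpa [hz, hg] using this.const_sub 1
        · have hz' : f z = 0 := by rw [← Function.notMem_support, hfs]; exact hz
          simp [hz, hg, hz']
    have := tendsto_nhds_unique (hlim μ)
      ((hlim μ').congr fun n => (h _ (hgd n) (hgc n)).symm)
    exact (measureReal_eq_measureReal_iff).1 this
  · simp

/-- The partial derivative `∂ₓψ`. -/
def dx (ψ : ℝ × ℝ → ℝ) (z : ℝ × ℝ) : ℝ := deriv (fun x => ψ (x, z.2)) z.1

/-- The rate of change `⟨μ_s, b_s ∂ₓψ⟩`. -/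
def flux (μ : ℝ → Measure (ℝ × ℝ)) (b : ℝ → ℝ × ℝ → ℝ) (ψ : ℝ × ℝ → ℝ) (s : ℝ) : ℝ :=
  ∫ z, b s z * dx ψ z ∂(μ s)

/-- A curve of probability measures solving `∂ₜμ + ∂ₓ(bμ) = 0` weakly, where `b` has at most
linear growth in `x`, uniformly up to a time-dependent constant. -/
structure TransportCurve (μ : ℝ → Measure (ℝ × ℝ)) (b : ℝ → ℝ × ℝ → ℝ) (V : ℝ → ℝ → ℝ)
    (C L : ℝ) : Prop where
  C_nonneg : 0 ≤ C
  L_pos : 0 < L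
  prob : ∀ s, 0 ≤ s → IsProbabilityMeasure (μ s)
  sq : ∀ s, 0 ≤ s → Integrable (fun z : ℝ × ℝ => z.1 ^ 2) (μ s)
  cont : ∀ s, 0 ≤ s → Continuous (b s)
  lin : ∀ s, 0 ≤ s → ∀ y, ∀ᵐ z ∂(μ s), |b s z - V s y| ≤ C * (1 + |z.1 - y|)
  bdd : ∀ s, 0 ≤ s → ∀ᵐ z ∂(μ s), |z.2| ≤ L
  vague : ∀ φ : ℝ × ℝ → ℝ, Continuous φ → HasCompactSupport φ →
    ContinuousOn (fun t => ∫ z, φ z ∂(μ t)) (Ici 0)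
  weak : ∀ φ : ℝ → ℝ × ℝ → ℝ,
    ContDiff ℝ 1 (fun q : ℝ × (ℝ × ℝ) => φ q.1 q.2) →
    HasCompactSupport (fun q : ℝ × (ℝ × ℝ) => φ q.1 q.2) →
    ∀ t : ℝ, 0 ≤ t →
      ∫ z, φ t z ∂(μ t) = (∫ z, φ 0 z ∂(μ 0)) +
        ∫ s in (0:ℝ)..t, ∫ z, (deriv (fun u => φ u z) s +
          b s z * deriv (fun x => φ s (x, z.2)) z.1) ∂(μ s)

lemma dx_eq_fderiv {ψ : ℝ × ℝ → ℝ} (hψ : Differentiable ℝ ψ) (z : ℝ × ℝ) :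
    dx ψ z = fderiv ℝ ψ z (1, 0) := by
  have h1 : HasDerivAt (fun x : ℝ => (x, z.2)) ((1 : ℝ), (0 : ℝ)) z.1 :=
    (hasDerivAt_id z.1).prodMk (hasDerivAt_const z.1 z.2)
  have h2 : HasFDerivAt ψ (fderiv ℝ ψ z) ((fun x : ℝ => (x, z.2)) z.1) := (hψ z).hasFDerivAt
  exact (h2.comp_hasDerivAt z.1 h1).deriv

lemma continuous_dx {ψ : ℝ × ℝ → ℝ} (hψ : ContDiff ℝ 1 ψ) : Continuous (dx ψ) := by
  have : dx ψ = fun z => fderiv ℝ ψ z (1, 0) :=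
    funext fun z => dx_eq_fderiv (hψ.differentiable one_ne_zero) z
  rw [this]
  exact (hψ.continuous_fderiv one_ne_zero).clm_apply continuous_const

lemma hasCompactSupport_dx {ψ : ℝ × ℝ → ℝ} (hψ : ContDiff ℝ 1 ψ) (hc : HasCompactSupport ψ) :
    HasCompactSupport (dx ψ) := by
  have : dx ψ = fun z => fderiv ℝ ψ z (1, 0) :=
    funext fun z => dx_eq_fderiv (hψ.differentiable one_ne_zero) z
  rw [this]
  exact (hc.fderiv (𝕜 := ℝ)).comp_left (g := fun l : ℝ × ℝ →L[ℝ] ℝ => l (1, 0)) (by simp)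

lemma dx_add {ψ φ : ℝ × ℝ → ℝ} (hψ : ContDiff ℝ 1 ψ) (hφ : ContDiff ℝ 1 φ) (z : ℝ × ℝ) :
    dx (fun z => ψ z + φ z) z = dx ψ z + dx φ z := by
  rw [dx_eq_fderiv ((hψ.add hφ).differentiable one_ne_zero),
    dx_eq_fderiv (hψ.differentiable one_ne_zero), dx_eq_fderiv (hφ.differentiable one_ne_zero)]
  have := fderiv_add (hψ.differentiable one_ne_zero z) (hφ.differentiable one_ne_zero z)
  change fderiv ℝ (ψ + φ) z (1, 0) = _
  rw [this]
  rfl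

namespace TransportCurve

variable {μ : ℝ → Measure (ℝ × ℝ)} {b : ℝ → ℝ × ℝ → ℝ} {V : ℝ → ℝ → ℝ} {C L : ℝ}

lemma integral_eq (h : TransportCurve μ b V C L) {ψ : ℝ × ℝ → ℝ} (hψ : ContDiff ℝ 1 ψ)
    (hc : HasCompactSupport ψ) {t : ℝ} (ht : 0 ≤ t) :
    ∫ z, ψ z ∂(μ t) = (∫ z, ψ z ∂(μ 0)) + ∫ s in (0:ℝ)..t, flux μ b ψ s := by
  let χ : ContDiffBump (0 : ℝ) := ⟨t + 1, t + 2, by linarith, by linarith⟩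
  have hχ1 : ∀ s, |s| ≤ t + 1 → χ s = 1 := fun s hs =>
    χ.one_of_mem_closedBall (by simpa using hs)
  have hχd : ContDiff ℝ 1 (χ : ℝ → ℝ) := χ.contDiff
  have h1 := h.weak (fun u z => χ u * ψ z)
    ((hχd.comp contDiff_fst).mul (hψ.comp contDiff_snd)) (by
      refine HasCompactSupport.intro (χ.hasCompactSupport.isCompact.prod hc.isCompact) ?_
      intro q hq
      by_cases hq1 : q.1 ∈ tsupport χ
      · have hq2 : q.2 ∉ tsupport ψ := fun h2 => hq ⟨hq1, h2⟩
        rw [image_eq_zero_of_notMem_tsupport hq2, mul_zero]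
      · rw [image_eq_zero_of_notMem_tsupport hq1, zero_mul]) t ht
  simp only [hχ1 t (by rw [abs_of_nonneg ht]; linarith),
    hχ1 0 (by rw [abs_zero]; linarith), one_mul] at h1
  rw [h1]
  congr 1
  refine intervalIntegral.integral_congr fun s hs => ?_
  rw [uIcc_of_le ht] at hs
  have hs1 : |s| ≤ t + 1 := by rw [abs_of_nonneg hs.1]; linarith [hs.2]
  refine integral_congr_ae (Eventually.of_forall fun z => ?_)
  have hd : deriv (fun u => χ u * ψ z) s = 0 := by
    have : (fun u => χ u * ψ z) =ᶠ[nhds s] fun _ => ψ z := by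
      have : Metric.ball (0:ℝ) (t + 1) ∈ nhds s :=
        Metric.isOpen_ball.mem_nhds (by
          simp only [Metric.mem_ball, dist_zero_right, Real.norm_eq_abs, abs_of_nonneg hs.1]
          linarith [hs.2])
      filter_upwards [this] with u hu
      rw [hχ1 u (by simpa using (Metric.mem_ball.1 hu).le), one_mul]
    rw [this.deriv_eq, deriv_const]
  simp only [hd, hχ1 s hs1, one_mul, zero_add, dx]

lemma integrable_flux_integrand (h : TransportCurve μ b V C L) {ψ : ℝ × ℝ → ℝ}
    (hψ : ContDiff ℝ 1 ψ) (hc : HasCompactSupport ψ) {s : ℝ} (hs : 0 ≤ s) :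
    Integrable (fun z => b s z * dx ψ z) (μ s) := by
  have := h.prob s hs
  exact ((h.cont s hs).mul (continuous_dx hψ)).integrable_of_hasCompactSupport
    ((hasCompactSupport_dx hψ hc).mul_left)

lemma flux_add (h : TransportCurve μ b V C L) {ψ φ : ℝ × ℝ → ℝ}
    (hψ : ContDiff ℝ 1 ψ) (hc : HasCompactSupport ψ) (hφ : ContDiff ℝ 1 φ)
    (hc' : HasCompactSupport φ) {s : ℝ} (hs : 0 ≤ s) :
    flux μ b (fun z => ψ z + φ z) s = flux μ b ψ s + flux μ b φ s := by
  simp only [flux, dx_add hψ hφ, mul_add]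
  exact integral_add (h.integrable_flux_integrand hψ hc hs) (h.integrable_flux_integrand hφ hc' hs)

end TransportCurve

/-- All fluxes of test functions are integrable on `[0, T]`. -/
def FluxIntegrable (μ : ℝ → Measure (ℝ × ℝ)) (b : ℝ → ℝ × ℝ → ℝ) (T : ℝ) : Prop :=
  ∀ ψ : ℝ × ℝ → ℝ, ContDiff ℝ 1 ψ → HasCompactSupport ψ →
    IntervalIntegrable (flux μ b ψ) volume 0 T

lemma FluxIntegrable.mono {μ : ℝ → Measure (ℝ × ℝ)} {b : ℝ → ℝ × ℝ → ℝ} {T T' : ℝ}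
    (h : FluxIntegrable μ b T) (h0 : 0 ≤ T') (h1 : T' ≤ T) : FluxIntegrable μ b T' :=
  fun ψ hψ hc => (h ψ hψ hc).mono_set (by
    rw [uIcc_of_le h0, uIcc_of_le (h0.trans h1)]; exact Icc_subset_Icc_right h1)

namespace TransportCurve

variable {μ : ℝ → Measure (ℝ × ℝ)} {b : ℝ → ℝ × ℝ → ℝ} {V : ℝ → ℝ → ℝ} {C L : ℝ}

lemma eq_initial_of_not_fluxIntegrable (h : TransportCurve μ b V C L) {T t : ℝ} (hT : 0 ≤ T)
    (hb : ¬ FluxIntegrable μ b T) (ht : T ≤ t) : μ t = μ 0 := by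
  have hb' : ¬ FluxIntegrable μ b t := fun hg => hb (hg.mono hT ht)
  have ht0 : 0 ≤ t := hT.trans ht
  have := h.prob t ht0
  have := h.prob 0 le_rfl
  simp only [FluxIntegrable, not_forall] at hb'
  obtain ⟨φ, hφ, hφc, hφb⟩ := hb'
  have key : ∀ ψ : ℝ × ℝ → ℝ, ContDiff ℝ 1 ψ → HasCompactSupport ψ →
      ¬ IntervalIntegrable (flux μ b ψ) volume 0 t → ∫ z, ψ z ∂(μ t) = ∫ z, ψ z ∂(μ 0) := by
    intro ψ hψ hc hi
    rw [h.integral_eq hψ hc ht0, intervalIntegral.integral_undef hi, add_zero]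
  refine Measure.ext_of_contDiff fun ψ hψ hc => ?_
  by_cases hi : IntervalIntegrable (flux μ b ψ) volume 0 t
  · have h1 := key (fun z => ψ z + φ z) (hψ.add hφ) (hc.add hφc) fun hi' => hφb <| by
      refine (hi'.sub hi).congr fun s hs => ?_
      rw [uIoc_of_le ht0] at hs
      change flux μ b (fun z => ψ z + φ z) s - flux μ b ψ s = flux μ b φ s
      rw [h.flux_add hψ hc hφ hφc hs.1.le]
      ring
    have int : ∀ (ψ : ℝ × ℝ → ℝ) (m : Measure (ℝ × ℝ)) [IsProbabilityMeasure m],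
        ContDiff ℝ 1 ψ → HasCompactSupport ψ → Integrable ψ m := fun ψ m _ hψ hc =>
      hψ.continuous.integrable_of_hasCompactSupport hc
    rw [integral_add (int ψ _ hψ hc) (int φ _ hφ hφc),
      integral_add (int ψ _ hψ hc) (int φ _ hφ hφc), key φ hφ hφc hφb] at h1
    linarith
  · exact key ψ hψ hc hi

end TransportCurve

section Truncation

open Topology

lemma exists_truncation {L : ℝ} (hL : 0 < L) :
    ∃ D : ℝ, 0 ≤ D ∧ ∃ χ χ' : ℕ → ℝ → ℝ, (∀ n x, 0 ≤ χ n x ∧ χ n x ≤ 1) ∧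
      (∀ (n : ℕ) (x : ℝ), |x| < (n : ℝ) + 1 → χ n x = 1 ∧ χ' n x = 0) ∧
      (∀ n x, |χ' n x| * (1 + |x|) ≤ D) ∧
      ∀ p : ℝ → ℝ, ContDiff ℝ 1 p → ∀ n, ∃ ψ : ℝ × ℝ → ℝ, ContDiff ℝ 1 ψ ∧ HasCompactSupport ψ ∧
        ∀ z : ℝ × ℝ, |z.2| ≤ L → ψ z = p z.1 * χ n z.1 ∧
          dx ψ z = deriv p z.1 * χ n z.1 + p z.1 * χ' n z.1 := by
  let θ : ContDiffBump (0 : ℝ) := ⟨1, 2, by norm_num, by norm_num⟩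
  have hθ1 : ∀ s, |s| ≤ 1 → θ s = 1 := fun s hs => θ.one_of_mem_closedBall (by simpa using hs)
  have hθd : ContDiff ℝ 1 (θ : ℝ → ℝ) := θ.contDiff
  have hθ0 : ∀ s, 2 ≤ |s| → θ s = 0 := fun s hs =>
    θ.zero_of_le_dist (by simpa using hs)
  have hθc : Continuous (fun x => deriv θ x * (1 + |x|)) :=
    (hθd.continuous_deriv le_rfl).mul (continuous_const.add continuous_abs)
  have hθs : HasCompactSupport (fun x => deriv θ x * (1 + |x|)) :=
    (θ.hasCompactSupport.deriv).mul_right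
  obtain ⟨D, hD⟩ := hθs.exists_bound_of_continuous hθc
  have hD' : ∀ x, |deriv θ x| * (1 + |x|) ≤ D := fun x => by
    have := hD x
    rwa [Real.norm_eq_abs, abs_mul, abs_of_nonneg (by positivity : 0 ≤ 1 + |x|)] at this
  have hder : ∀ (n : ℕ) (x : ℝ),
      HasDerivAt (fun x => θ (x / (n + 1))) (deriv θ (x / (n + 1)) / (n + 1)) x := by
    intro n x
    have h1 : HasDerivAt (fun x : ℝ => x / (n + 1)) (1 / (n + 1)) x := (hasDerivAt_id x).div_const _
    have h2 := ((hθd.differentiable one_ne_zero) (x / (n + 1))).hasDerivAt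
    have := h2.comp x h1
    rw [mul_one_div] at this
    exact this
  refine ⟨D, (by positivity : (0:ℝ) ≤ |deriv θ 0| * (1 + |0|)).trans (hD' 0),
    fun n x => θ (x / (n + 1)), fun n x => deriv θ (x / (n + 1)) / (n + 1),
    fun n x => ⟨θ.nonneg, θ.le_one⟩, fun n x hx => ?_, fun n x => ?_, fun p hp n => ?_⟩
  · have h0 : (0:ℝ) < n + 1 := by positivity
    have h1 : ∀ y : ℝ, |y| < n + 1 → θ (y / (n + 1)) = 1 := fun y hy => hθ1 _ (by
      rw [abs_div, abs_of_pos h0, div_le_one h0]; exact hy.le)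
    refine ⟨h1 x hx, ?_⟩
    have h2 : (fun x : ℝ => θ (x / (n + 1))) =ᶠ[𝓝 x] fun _ => 1 := by
      filter_upwards [(isOpen_lt continuous_abs continuous_const).mem_nhds hx] with y hy
      exact h1 y hy
    have := (hder n x).deriv
    rw [h2.deriv_eq, deriv_const] at this
    exact this.symm
  · have h0 : (0:ℝ) < n + 1 := by positivity
    refine le_trans ?_ (hD' (x / (n + 1)))
    rw [abs_div, abs_of_pos h0, div_mul_eq_mul_div, mul_div_assoc, abs_div, abs_of_pos h0, add_div]
    gcongr
    rw [div_le_one h0]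
    linarith [(Nat.cast_nonneg n : (0:ℝ) ≤ n)]
  · have h0 : (0:ℝ) < n + 1 := by positivity
    refine ⟨fun z => p z.1 * θ (z.1 / (n + 1)) * θ (z.2 / L), ?_, ?_, ?_⟩
    · exact ((hp.comp contDiff_fst).mul (hθd.comp (contDiff_fst.div_const _))).mul
        (hθd.comp (contDiff_snd.div_const _))
    · refine HasCompactSupport.intro (K := Metric.closedBall 0 (2 * (n + 1)) ×ˢ
        Metric.closedBall 0 (2 * L)) ((isCompact_closedBall _ _).prod (isCompact_closedBall _ _)) ?_
      intro z hz
      simp only [mem_prod, Metric.mem_closedBall, dist_zero_right, Real.norm_eq_abs, not_and_or,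
        not_le] at hz
      rcases hz with hz | hz
      · rw [hθ0 (z.1 / (n + 1)) (by
          rw [abs_div, abs_of_pos h0, le_div_iff₀ h0]; exact hz.le), mul_zero, zero_mul]
      · rw [hθ0 (z.2 / L) (by
          rw [abs_div, abs_of_pos hL, le_div_iff₀ hL]; exact hz.le), mul_zero]
    · intro z hz
      have h1 : θ (z.2 / L) = 1 := hθ1 _ (by rw [abs_div, abs_of_pos hL, div_le_one hL]; exact hz)
      refine ⟨by simp only [h1, mul_one], ?_⟩
      simp only [dx, h1, mul_one]
      exact (((hp.differentiable one_ne_zero) z.1).hasDerivAt.mul (hder n z.1)).deriv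

end Truncation

namespace TransportCurve

open Topology

variable {μ : ℝ → Measure (ℝ × ℝ)} {b : ℝ → ℝ × ℝ → ℝ} {V : ℝ → ℝ → ℝ} {C L : ℝ}

lemma continuousOn_integral (h : TransportCurve μ b V C L) {f : ℝ × ℝ → ℝ} (hf : Continuous f)
    {K : ℝ} (hK : ∀ z, |f z| ≤ K) : ContinuousOn (fun s => ∫ z, f z ∂(μ s)) (Ici 0) :=
  fun t ht => continuousWithinAt_integral_of_vague ht h.prob
    (fun φ hφ hc => h.vague φ hφ hc t ht) hf hK

lemma abs_inv_one_add_sq_le (x : ℝ) : |1 / (1 + x ^ 2)| ≤ 1 := by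
  rw [abs_of_nonneg (by positivity), div_le_one (by positivity)]
  nlinarith [sq_nonneg x]

lemma continuous_inv_one_add_sq : Continuous fun z : ℝ × ℝ => 1 / (1 + z.1 ^ 2) :=
  continuous_const.div (by fun_prop) fun z => by positivity

lemma exists_pos_le (h : TransportCurve μ b V C L) {T : ℝ} (hT : 0 ≤ T) :
    ∃ c > 0, ∀ s ∈ Icc 0 T, c ≤ ∫ z, 1 / (1 + z.1 ^ 2) ∂(μ s) := by
  have hc := (h.continuousOn_integral continuous_inv_one_add_sq
    fun z => abs_inv_one_add_sq_le z.1).mono (Icc_subset_Ici_self : Icc 0 T ⊆ Ici 0)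
  obtain ⟨s, hs, hmin⟩ := isCompact_Icc.exists_isMinOn ⟨0, le_rfl, hT⟩ hc
  refine ⟨_, ?_, fun t ht => hmin ht⟩
  have := h.prob s hs.1
  have hi : Integrable (fun z : ℝ × ℝ => 1 / (1 + z.1 ^ 2)) (μ s) :=
    Integrable.of_bound continuous_inv_one_add_sq.aestronglyMeasurable 1
      (Eventually.of_forall fun z => abs_inv_one_add_sq_le z.1)
  change 0 < ∫ z, 1 / (1 + z.1 ^ 2) ∂(μ s)
  rw [integral_pos_iff_support_of_nonneg (fun z => by positivity) hi]
  have : Function.support (fun z : ℝ × ℝ => 1 / (1 + z.1 ^ 2)) = univ :=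
    eq_univ_of_forall fun z => by
      have : 0 < 1 + z.1 ^ 2 := by positivity
      simp only [Function.mem_support]; positivity
  rw [this]
  simp

lemma integrable_abs (h : TransportCurve μ b V C L) {s : ℝ} (hs : 0 ≤ s) :
    Integrable (fun z : ℝ × ℝ => |z.1|) (μ s) := by
  have := h.prob s hs
  refine ((h.sq s hs).add (integrable_const 1)).mono' (by fun_prop)
    (Eventually.of_forall fun z => ?_)
  simp only [Real.norm_eq_abs, abs_abs, Pi.add_apply]
  nlinarith [sq_abs z.1, sq_nonneg (|z.1| - 1), abs_nonneg z.1]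

lemma exists_integrable_bound (h : TransportCurve μ b V C L) {T : ℝ} (hT : 0 ≤ T)
    (hg : FluxIntegrable μ b T) :
    ∃ G : ℝ → ℝ, (∀ s, 0 ≤ G s) ∧ IntervalIntegrable G volume 0 T ∧
      ∀ s ∈ Icc 0 T, |V s 0| ≤ G s := by
  obtain ⟨c, hc, hcT⟩ := h.exists_pos_le hT
  obtain ⟨D, hD, χ, χ', hχ01, hχ1, hχD, hψ⟩ := exists_truncation h.L_pos
  have hC := h.C_nonneg
  obtain ⟨n, hn⟩ := exists_nat_gt ((1 + 2 * D) / (c / 2))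
  have hn1 : (1 + 2 * D) / (n + 1) ≤ c / 2 := by
    rw [div_lt_iff₀ (by positivity)] at hn
    rw [div_le_iff₀ (by positivity)]
    nlinarith
  obtain ⟨φ, hφ, hφc, hφL⟩ := hψ arctan contDiff_arctan n
  have hat : ∀ x, |arctan x| ≤ 2 := fun x => abs_le.2
    ⟨by linarith [neg_pi_div_two_lt_arctan x, pi_le_four],
      by linarith [arctan_lt_pi_div_two x, pi_le_four]⟩
  have hd : ∀ z : ℝ × ℝ, |z.2| ≤ L → dx φ z = 1 / (1 + z.1 ^ 2) * χ n z.1 +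
      arctan z.1 * χ' n z.1 := fun z hz => by rw [(hφL z hz).2, Real.deriv_arctan]
  have hd1 : ∀ z : ℝ × ℝ, |z.2| ≤ L → 1 / (1 + z.1 ^ 2) - c / 2 ≤ dx φ z := by
    intro z hz
    rw [hd z hz]
    by_cases hx : |z.1| < n + 1
    · rw [(hχ1 n z.1 hx).1, (hχ1 n z.1 hx).2]; linarith
    · push Not at hx
      have h0 : (0:ℝ) < n + 1 := by positivity
      have h1 : 1 / (1 + z.1 ^ 2) ≤ 1 / (n + 1) := by
        apply one_div_le_one_div_of_le h0
        nlinarith [sq_abs z.1, (Nat.cast_nonneg n : (0:ℝ) ≤ n)]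
      have h2 : |χ' n z.1| ≤ D / (n + 1) := by
        rw [le_div_iff₀ h0]
        exact (mul_le_mul_of_nonneg_left (by linarith) (abs_nonneg _)).trans (hχD n z.1)
      have h3 : 0 ≤ 1 / (1 + z.1 ^ 2) * χ n z.1 := mul_nonneg (by positivity) (hχ01 n z.1).1
      have h4 : |arctan z.1 * χ' n z.1| ≤ 2 * (D / (n + 1)) := by
        rw [abs_mul]; exact mul_le_mul (hat _) h2 (abs_nonneg _) (by norm_num)
      have h5 : (1 + 2 * D) / (n + 1) = 1 / (n + 1) + 2 * (D / ((n:ℝ) + 1)) := by ring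
      linarith [(abs_le.1 h4).1]
  have hd2 : ∀ z : ℝ × ℝ, |z.2| ≤ L → (1 + |z.1|) * |dx φ z| ≤ 2 + 2 * D := by
    intro z hz
    rw [hd z hz]
    have h1 : |1 / (1 + z.1 ^ 2) * χ n z.1| ≤ 1 / (1 + z.1 ^ 2) := by
      rw [abs_mul, abs_of_nonneg (hχ01 n z.1).1, abs_of_nonneg (by positivity)]
      exact mul_le_of_le_one_right (by positivity) (hχ01 n z.1).2
    have h2 : |arctan z.1 * χ' n z.1| ≤ 2 * |χ' n z.1| := by
      rw [abs_mul]; exact mul_le_mul_of_nonneg_right (hat _) (abs_nonneg _)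
    have h3 : (1 + |z.1|) * (1 / (1 + z.1 ^ 2)) ≤ 2 := by
      rw [mul_one_div, div_le_iff₀ (by positivity)]
      nlinarith [sq_abs z.1, sq_nonneg (|z.1| - 1), abs_nonneg z.1]
    have h4 := hχD n z.1
    have h5 := abs_add_le (1 / (1 + z.1 ^ 2) * χ n z.1) (arctan z.1 * χ' n z.1)
    nlinarith [abs_nonneg z.1]
  refine ⟨fun s => 2 / c * (|flux μ b φ s| + C * (2 + 2 * D)), fun s => by positivity, ?_, ?_⟩
  · exact ((hg φ hφ hφc).abs.add intervalIntegrable_const).const_mul _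
  · intro s hs
    have := h.prob s hs.1
    have hif : Integrable (fun z => b s z * dx φ z) (μ s) := h.integrable_flux_integrand hφ hφc hs.1
    have hid : Integrable (dx φ) (μ s) :=
      (continuous_dx hφ).integrable_of_hasCompactSupport (hasCompactSupport_dx hφ hφc)
    have ha : c / 2 ≤ ∫ z, dx φ z ∂(μ s) := by
      have hi : Integrable (fun z : ℝ × ℝ => 1 / (1 + z.1 ^ 2)) (μ s) :=
        Integrable.of_bound continuous_inv_one_add_sq.aestronglyMeasurable 1
          (Eventually.of_forall fun z => abs_inv_one_add_sq_le z.1)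
      have h1 : ∫ z, (1 / (1 + z.1 ^ 2) - c / 2) ∂(μ s) ≤ ∫ z, dx φ z ∂(μ s) := by
        refine integral_mono_ae (hi.sub (integrable_const _)) hid ?_
        filter_upwards [h.bdd s hs.1] with z hz using hd1 z hz
      rw [integral_sub hi (integrable_const _), integral_const, probReal_univ, one_smul] at h1
      linarith [hcT s hs]
    have he : |flux μ b φ s - V s 0 * ∫ z, dx φ z ∂(μ s)| ≤ C * (2 + 2 * D) := by
      rw [flux, ← integral_const_mul, ← integral_sub hif (hid.const_mul _), ← Real.norm_eq_abs]
      refine (norm_integral_le_of_norm_le_const (C := C * (2 + 2 * D)) ?_).trans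
        (by simp)
      filter_upwards [h.bdd s hs.1, h.lin s hs.1 0] with z hz hl
      rw [← sub_mul, Real.norm_eq_abs, abs_mul]
      rw [sub_zero] at hl
      calc _ ≤ C * (1 + |z.1|) * |dx φ z| := by gcongr
        _ = C * ((1 + |z.1|) * |dx φ z|) := by ring
        _ ≤ _ := by gcongr; exact hd2 z hz
    have h1 : |V s 0| * (c / 2) ≤ |flux μ b φ s| + C * (2 + 2 * D) := by
      have h2 : |V s 0| * (c / 2) ≤ |V s 0 * ∫ z, dx φ z ∂(μ s)| := by
        rw [abs_mul]
        gcongr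
        exact ha.trans (le_abs_self _)
      have := abs_sub_abs_le_abs_sub (V s 0 * ∫ z, dx φ z ∂(μ s)) (flux μ b φ s)
      rw [abs_sub_comm] at this
      linarith
    have : |V s 0| = 2 / c * (|V s 0| * (c / 2)) := by field_simp
    rw [this]
    exact mul_le_mul_of_nonneg_left h1 (by positivity)

lemma abs_velocity_le (h : TransportCurve μ b V C L) {s : ℝ} (hs : 0 ≤ s) :
    ∀ᵐ z ∂(μ s), |b s z| ≤ (|V s 0| + C) * (1 + |z.1|) := by
  filter_upwards [h.lin s hs 0] with z hz
  rw [sub_zero] at hz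
  have := abs_sub_abs_le_abs_sub (b s z) (V s 0)
  nlinarith [mul_nonneg (abs_nonneg (V s 0)) (abs_nonneg z.1)]

lemma integral_eq_of_growth (h : TransportCurve μ b V C L) {T : ℝ} (hT : 0 ≤ T)
    (hg : FluxIntegrable μ b T) {p w : ℝ → ℝ} {K C' : ℝ} (hp : ContDiff ℝ 1 p)
    (hw0 : ∀ x, 0 ≤ w x) (hw : ∀ s ∈ Icc 0 T, Integrable (fun z => w z.1) (μ s))
    (hK : ∀ s ∈ Icc 0 T, ∫ z, w z.1 ∂(μ s) ≤ K) (hC' : 0 ≤ C') (h1 : ∀ x, |p x| ≤ C' * w x)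
    (h2 : ∀ x, |deriv p x| * (1 + |x|) ≤ C' * w x) :
    IntervalIntegrable (fun s => ∫ z, b s z * deriv p z.1 ∂(μ s)) volume 0 T ∧
    ∀ t ∈ Icc 0 T, ∫ z, p z.1 ∂(μ t) = (∫ z, p z.1 ∂(μ 0)) +
      ∫ s in (0:ℝ)..t, ∫ z, b s z * deriv p z.1 ∂(μ s) := by
  obtain ⟨G, hG0, hGi, hGV⟩ := h.exists_integrable_bound hT hg
  obtain ⟨D, hD, χ, χ', hχ01, hχ1, hχD, hψ⟩ := exists_truncation h.L_pos
  choose ψ hψd hψc hψL using hψ p hp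
  have hC := h.C_nonneg
  have hev : ∀ x : ℝ, ∀ᶠ n : ℕ in atTop, χ n x = 1 ∧ χ' n x = 0 := fun x => by
    obtain ⟨N, hN⟩ := exists_nat_gt |x|
    filter_upwards [eventually_ge_atTop N] with n hn
    refine hχ1 n x (hN.trans ?_)
    have : (N:ℝ) ≤ n := by exact_mod_cast hn
    linarith
  have hbd : ∀ s ∈ Icc 0 T, ∀ n, ∀ᵐ z ∂(μ s),
      ‖b s z * dx (ψ n) z‖ ≤ (G s + C) * (C' * (1 + D)) * w z.1 := by
    intro s hs n
    filter_upwards [h.bdd s hs.1, h.abs_velocity_le hs.1] with z hz hb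
    rw [(hψL n z hz).2, Real.norm_eq_abs, abs_mul]
    have h3 : |deriv p z.1 * χ n z.1 + p z.1 * χ' n z.1| ≤
        |deriv p z.1| + |p z.1| * |χ' n z.1| := by
      refine (abs_add_le _ _).trans ?_
      rw [abs_mul, abs_mul, abs_of_nonneg (hχ01 n z.1).1]
      gcongr
      exact mul_le_of_le_one_right (abs_nonneg _) (hχ01 n z.1).2
    have h4 : |b s z| ≤ (G s + C) * (1 + |z.1|) := hb.trans (by gcongr; exact hGV s hs)
    have h5 : (1 + |z.1|) * (|deriv p z.1| + |p z.1| * |χ' n z.1|) ≤ C' * (1 + D) * w z.1 := by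
      have h6 : |p z.1| * (|χ' n z.1| * (1 + |z.1|)) ≤ C' * w z.1 * D :=
        mul_le_mul (h1 _) (hχD n _) (by positivity) (mul_nonneg hC' (hw0 _))
      linarith [h2 z.1]
    calc _ ≤ (G s + C) * (1 + |z.1|) * (|deriv p z.1| + |p z.1| * |χ' n z.1|) :=
          mul_le_mul h4 h3 (abs_nonneg _) (by have := hG0 s; positivity)
      _ = (G s + C) * ((1 + |z.1|) * (|deriv p z.1| + |p z.1| * |χ' n z.1|)) := by ring
      _ ≤ (G s + C) * (C' * (1 + D) * w z.1) :=
          mul_le_mul_of_nonneg_left h5 (add_nonneg (hG0 s) hC)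
      _ = _ := by ring
  have hlim : ∀ s ∈ Icc 0 T, Tendsto (fun n => flux μ b (ψ n) s) atTop
      (𝓝 (∫ z, b s z * deriv p z.1 ∂(μ s))) := by
    intro s hs
    refine tendsto_integral_of_dominated_convergence _
      (fun n => ((h.cont s hs.1).mul (continuous_dx (hψd n))).aestronglyMeasurable)
      ((hw s hs).const_mul _) (hbd s hs) ?_
    filter_upwards [h.bdd s hs.1] with z hz
    refine tendsto_const_nhds.congr' ?_
    filter_upwards [hev z.1] with n hn
    rw [(hψL n z hz).2, hn.1, hn.2, mul_one, mul_zero, add_zero]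
  have hfl : ∀ s ∈ Icc 0 T, ∀ n, ‖flux μ b (ψ n) s‖ ≤ (G s + C) * (C' * (1 + D)) * K := by
    intro s hs n
    refine (norm_integral_le_of_norm_le ((hw s hs).const_mul _) (hbd s hs n)).trans ?_
    rw [integral_const_mul]
    have := hG0 s
    gcongr
    exact hK s hs
  have hbi : IntervalIntegrable (fun s => (G s + C) * (C' * (1 + D)) * K) volume 0 T :=
    ((hGi.add intervalIntegrable_const).mul_const _).mul_const _
  have hIoc : ∀ t ∈ Icc 0 T, Ioc 0 t ⊆ Icc 0 T := fun t ht s hs => ⟨hs.1.le, hs.2.trans ht.2⟩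
  constructor
  · have hTT : T ∈ Icc 0 T := ⟨hT, le_rfl⟩
    rw [intervalIntegrable_iff_integrableOn_Ioc_of_le hT] at hbi ⊢
    refine hbi.mono' (aestronglyMeasurable_of_tendsto_ae atTop
      (f := fun n => flux μ b (ψ n)) (fun n => ?_) ?_) ?_
    · have := hg (ψ n) (hψd n) (hψc n)
      rw [intervalIntegrable_iff_integrableOn_Ioc_of_le hT] at this
      exact this.aestronglyMeasurable
    · filter_upwards [ae_restrict_mem measurableSet_Ioc] with s hs using hlim s (hIoc T hTT hs)
    · filter_upwards [ae_restrict_mem measurableSet_Ioc] with s hs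
      exact le_of_tendsto (hlim s (hIoc T hTT hs)).norm
        (Eventually.of_forall (hfl s (hIoc T hTT hs)))
  · intro t ht
    have hpt : ∀ s ∈ Icc 0 T, Tendsto (fun n => ∫ z, ψ n z ∂(μ s)) atTop
        (𝓝 (∫ z, p z.1 ∂(μ s))) := by
      intro s hs
      refine tendsto_integral_of_dominated_convergence _
        (fun n => (hψd n).continuous.aestronglyMeasurable)
        ((hw s hs).const_mul C') (fun n => ?_) ?_
      · filter_upwards [h.bdd s hs.1] with z hz
        rw [(hψL n z hz).1, Real.norm_eq_abs, abs_mul, abs_of_nonneg (hχ01 n z.1).1]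
        exact (mul_le_of_le_one_right (abs_nonneg _) (hχ01 n z.1).2).trans (h1 _)
      · filter_upwards [h.bdd s hs.1] with z hz
        refine tendsto_const_nhds.congr' ?_
        filter_upwards [hev z.1] with n hn
        rw [(hψL n z hz).1, hn.1, mul_one]
    have hgt := hg.mono ht.1 ht.2
    have hint : Tendsto (fun n => ∫ s in (0:ℝ)..t, flux μ b (ψ n) s) atTop
        (𝓝 (∫ s in (0:ℝ)..t, ∫ z, b s z * deriv p z.1 ∂(μ s))) := by
      refine intervalIntegral.tendsto_integral_filter_of_dominated_convergence
        (fun s => (G s + C) * (C' * (1 + D)) * K) (Eventually.of_forall fun n => ?_)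
        (Eventually.of_forall fun n => Eventually.of_forall fun s hs => ?_) ?_
        (Eventually.of_forall fun s hs => ?_)
      · have := hgt (ψ n) (hψd n) (hψc n)
        rw [uIoc_of_le ht.1]
        rw [intervalIntegrable_iff_integrableOn_Ioc_of_le ht.1] at this
        exact this.aestronglyMeasurable
      · rw [uIoc_of_le ht.1] at hs
        exact hfl s (hIoc t ht hs) n
      · refine hbi.mono_set ?_
        rw [uIcc_of_le ht.1, uIcc_of_le hT]
        exact Icc_subset_Icc_right ht.2
      · rw [uIoc_of_le ht.1] at hs
        exact hlim s (hIoc t ht hs)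
    refine tendsto_nhds_unique (hpt t ht) (((hpt 0 ⟨le_rfl, hT⟩).add hint).congr fun n => ?_)
    exact (h.integral_eq (hψd n) (hψc n) ht.1).symm

end TransportCurve

/-- A Grönwall-type inequality for bounded functions without continuity requirements. -/
lemma exists_le_mul_of_increment_le {T : ℝ} {K : ℝ → ℝ}
    (hK : ContinuousOn K (Icc 0 T)) :
    ∃ N : ℝ, ∀ T' ∈ Icc 0 T, ∀ u : ℝ → ℝ, (∀ s ∈ Icc 0 T', 0 ≤ u s) →
      BddAbove (u '' Icc 0 T') →
      (∀ s t U, 0 ≤ s → s ≤ t → t ≤ T' → (∀ r ∈ Icc s t, u r ≤ U) →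
        u t ≤ u s + U * (K t - K s)) →
      ∀ t ∈ Icc 0 T', u t ≤ N * u 0 := by
  obtain ⟨δ, hδ, hKδ⟩ := Metric.uniformContinuousOn_iff_le.1
    (isCompact_Icc.uniformContinuousOn_of_continuous hK) (1 / 2) (by norm_num)
  obtain ⟨n, hn⟩ := exists_nat_ge (T / δ)
  have hnT : T ≤ n * δ := (div_le_iff₀ hδ).1 hn
  refine ⟨2 ^ n, fun T' hT' u hu hub hinc => ?_⟩
  suffices H : ∀ k : ℕ, ∀ t ∈ Icc 0 T', t ≤ k * δ → u t ≤ 2 ^ k * u 0 from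
    fun t ht => H n t ht (ht.2.trans (hT'.2.trans hnT))
  intro k
  induction k with
  | zero =>
    intro t ht h0
    have : t = 0 := le_antisymm (by simpa using h0) ht.1
    simp [this]
  | succ k ih =>
    intro t ht htk
    by_cases hk : t ≤ k * δ
    · refine (ih t ht hk).trans ?_
      have := hu 0 ⟨le_rfl, hT'.1⟩
      gcongr <;> norm_num
    push Not at hk
    set s : ℝ := k * δ with hs
    have hs0 : 0 ≤ s := by positivity
    have hsub : Icc s t ⊆ Icc 0 T' := Icc_subset_Icc hs0 ht.2
    set U : ℝ := sSup (u '' Icc s t) with hU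
    have hbdd : BddAbove (u '' Icc s t) := hub.mono (image_mono hsub)
    have hle : ∀ r ∈ Icc s t, u r ≤ U := fun r hr => le_csSup hbdd ⟨r, hr, rfl⟩
    have hU0 : 0 ≤ U := (hu s (hsub ⟨le_rfl, hk.le⟩)).trans (hle s ⟨le_rfl, hk.le⟩)
    have hle2 : U ≤ u s + U * (1 / 2) := by
      refine csSup_le ⟨u s, s, ⟨le_rfl, hk.le⟩, rfl⟩ ?_
      rintro _ ⟨r, hr, rfl⟩
      refine (hinc s r U hs0 hr.1 (hr.2.trans ht.2)
        fun r' hr' => hle r' ⟨hr'.1, hr'.2.trans hr.2⟩).trans ?_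
      have h1 : dist (K r) (K s) ≤ 1 / 2 := by
        refine hKδ r ⟨hs0.trans hr.1, hr.2.trans (ht.2.trans hT'.2)⟩ s
          ⟨hs0, hk.le.trans (ht.2.trans hT'.2)⟩ ?_
        rw [Real.dist_eq, abs_of_nonneg (by linarith [hr.1])]
        push_cast at htk
        linarith [hr.2]
      have h2 : K r - K s ≤ 1 / 2 := (le_abs_self _).trans h1
      gcongr
    have h3 := ih s (hsub ⟨le_rfl, hk.le⟩) le_rfl
    rw [pow_succ]
    linarith [hle t ⟨hk.le, le_rfl⟩]

lemma hasDerivAt_truncated_sq {ε : ℝ} (hε : 0 < ε) (x : ℝ) :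
    HasDerivAt (fun x : ℝ => x ^ 2 / (1 + ε * x ^ 2)) (2 * x / (1 + ε * x ^ 2) ^ 2) x := by
  have h0 : 1 + ε * x ^ 2 ≠ 0 := by positivity
  have h1 : HasDerivAt (fun x : ℝ => x ^ 2) (2 * x) x := by simpa using hasDerivAt_pow 2 x
  refine (h1.fun_div ((h1.const_mul ε).const_add 1) h0).congr_deriv ?_
  congr 1
  ring

namespace TransportCurve

open Topology

variable {μ : ℝ → Measure (ℝ × ℝ)} {b : ℝ → ℝ × ℝ → ℝ} {V : ℝ → ℝ → ℝ} {C L : ℝ}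

lemma exists_second_moment_le (h : TransportCurve μ b V C L) {T : ℝ} (hT : 0 ≤ T)
    (hg : FluxIntegrable μ b T) : ∃ Q, ∀ s ∈ Icc 0 T, ∫ z, z.1 ^ 2 ∂(μ s) ≤ Q := by
  obtain ⟨G, hG0, hGi, hGV⟩ := h.exists_integrable_bound hT hg
  have hC := h.C_nonneg
  have hk : IntervalIntegrable (fun r => 3 * (G r + C)) volume 0 T :=
    (hGi.add intervalIntegrable_const).const_mul _
  have hKc : ContinuousOn (fun t => ∫ r in (0:ℝ)..t, 3 * (G r + C)) (Icc 0 T) := by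
    have := intervalIntegral.continuousOn_primitive_interval
      ((intervalIntegrable_iff' enorm_ne_top).1 hk)
    rwa [uIcc_of_le hT] at this
  obtain ⟨N, hN⟩ := exists_le_mul_of_increment_le hKc
  refine ⟨|N| * (1 + ∫ z, z.1 ^ 2 ∂(μ 0)), fun t ht => ?_⟩
  have hp0 : ∀ ε : ℝ, 0 < ε → ∀ x : ℝ, 0 ≤ x ^ 2 / (1 + ε * x ^ 2) := fun ε hε x => by positivity
  have hp1 : ∀ ε : ℝ, 0 < ε → ∀ x : ℝ, x ^ 2 / (1 + ε * x ^ 2) ≤ x ^ 2 := fun ε hε x =>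
    div_le_self (sq_nonneg x) (by nlinarith [sq_nonneg x, mul_nonneg hε.le (sq_nonneg x)])
  have hp2 : ∀ ε : ℝ, 0 < ε → ∀ x : ℝ, x ^ 2 / (1 + ε * x ^ 2) ≤ 1 / ε := fun ε hε x => by
    rw [div_le_div_iff₀ (by positivity) hε]; linarith
  have hpc : ∀ ε : ℝ, 0 < ε → Continuous fun x : ℝ => x ^ 2 / (1 + ε * x ^ 2) := fun ε hε =>
    Continuous.div (by fun_prop) (by fun_prop) fun x => by positivity
  have hpi : ∀ ε : ℝ, 0 < ε → ∀ s, 0 ≤ s →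
      Integrable (fun z : ℝ × ℝ => z.1 ^ 2 / (1 + ε * z.1 ^ 2)) (μ s) := fun ε hε s hs =>
    (h.sq s hs).mono' ((hpc ε hε).comp continuous_fst).aestronglyMeasurable
      (Eventually.of_forall fun z => by
        rw [Real.norm_eq_abs, abs_of_nonneg (hp0 ε hε _)]; exact hp1 ε hε _)
  have hmain : ∀ ε : ℝ, 0 < ε → ∫ z, z.1 ^ 2 / (1 + ε * z.1 ^ 2) ∂(μ t) ≤
      |N| * (1 + ∫ z, z.1 ^ 2 ∂(μ 0)) := by
    intro ε hε
    set p : ℝ → ℝ := fun x => x ^ 2 / (1 + ε * x ^ 2) with hp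
    have hpd : ContDiff ℝ 1 p :=
      (contDiff_id.pow 2).div (contDiff_const.add (contDiff_const.mul (contDiff_id.pow 2)))
        fun x => by positivity
    have hder : ∀ x, deriv p x = 2 * x / (1 + ε * x ^ 2) ^ 2 :=
      fun x => (hasDerivAt_truncated_sq hε x).deriv
    have hd1 : ∀ x, |deriv p x| * (1 + |x|) ≤ 3 * (1 + p x) := by
      intro x
      have h1 : (1:ℝ) ≤ 1 + ε * x ^ 2 := by nlinarith [mul_nonneg hε.le (sq_nonneg x)]
      have h2 : |deriv p x| ≤ 2 * |x| / (1 + ε * x ^ 2) := by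
        rw [hder, abs_div, abs_mul, abs_of_pos (by norm_num : (0:ℝ) < 2),
          abs_of_nonneg (by positivity : 0 ≤ (1 + ε * x ^ 2) ^ 2)]
        apply div_le_div_of_nonneg_left (by positivity) (by positivity)
        nlinarith
      have h3 : 2 * |x| / (1 + ε * x ^ 2) * (1 + |x|) ≤ 3 * (1 + p x) := by
        rw [hp]
        simp only
        rw [div_mul_eq_mul_div, div_le_iff₀ (by positivity)]
        have h4 : 3 * (1 + x ^ 2 / (1 + ε * x ^ 2)) * (1 + ε * x ^ 2) =
          3 * (1 + ε * x ^ 2) + 3 * x ^ 2 := by field_simp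
        rw [h4]
        nlinarith [sq_abs x, sq_nonneg (|x| - 1), mul_nonneg hε.le (sq_nonneg x)]
      exact (mul_le_mul_of_nonneg_right h2 (by positivity)).trans h3
    have hid := fun T' (h0 : 0 ≤ T') (h1 : T' ≤ T) =>
      h.integral_eq_of_growth h0 (hg.mono h0 h1) (p := p) (w := fun _ => 1) (K := 1)
      (C' := 3 * (1 + 1 / ε)) hpd (fun _ => zero_le_one)
      (fun s hs => by have := h.prob s hs.1; exact integrable_const _)
      (fun s hs => by have := h.prob s hs.1; simp) (by positivity)
      (fun x => by
        rw [abs_of_nonneg (hp0 ε hε x)]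
        have := hp2 ε hε x
        have : 0 < 1 / ε := by positivity
        linarith)
      (fun x => by linarith [hd1 x, hp2 ε hε x])
    obtain ⟨hii, hieq⟩ := hid T hT le_rfl
    have hrate : ∀ s ∈ Icc 0 T, ∫ z, b s z * deriv p z.1 ∂(μ s) ≤
        3 * (G s + C) * (1 + ∫ z, p z.1 ∂(μ s)) := by
      intro s hs
      have := h.prob s hs.1
      have hi1 : Integrable (fun z : ℝ × ℝ => 1 + p z.1) (μ s) :=
        (integrable_const _).add (hpi ε hε s hs.1)
      refine (le_abs_self _).trans ?_
      rw [← Real.norm_eq_abs]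
      refine (norm_integral_le_of_norm_le (hi1.const_mul (3 * (G s + C))) ?_).trans ?_
      · filter_upwards [h.abs_velocity_le hs.1] with z hz
        rw [Real.norm_eq_abs, abs_mul]
        have hGC : 0 ≤ G s + C := add_nonneg (hG0 s) hC
        calc _ ≤ (G s + C) * (1 + |z.1|) * |deriv p z.1| := by
              gcongr
              exact hz.trans (by gcongr; exact hGV s hs)
          _ = (G s + C) * (|deriv p z.1| * (1 + |z.1|)) := by ring
          _ ≤ (G s + C) * (3 * (1 + p z.1)) := mul_le_mul_of_nonneg_left (hd1 _) hGC
          _ = _ := by ring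
      · rw [integral_const_mul, integral_add (integrable_const _) (hpi ε hε s hs.1),
          integral_const, probReal_univ, one_smul]
    have hres := hN T ⟨hT, le_rfl⟩ (fun s => 1 + ∫ z, p z.1 ∂(μ s))
      (fun s hs => add_nonneg zero_le_one (integral_nonneg fun z => hp0 ε hε z.1)) ?_ ?_ t ht
    · have h1 : ∫ z, p z.1 ∂(μ 0) ≤ ∫ z, z.1 ^ 2 ∂(μ 0) :=
        integral_mono (hpi ε hε 0 le_rfl) (h.sq 0 le_rfl) fun z => hp1 ε hε z.1
      have h2 : 0 ≤ ∫ z, p z.1 ∂(μ 0) := integral_nonneg fun z => hp0 ε hε z.1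
      have h3 : N * (1 + ∫ z, p z.1 ∂(μ 0)) ≤ |N| * (1 + ∫ z, z.1 ^ 2 ∂(μ 0)) := by
        refine (mul_le_mul_of_nonneg_right (le_abs_self N) (by linarith)).trans ?_
        gcongr
      linarith
    · refine ⟨1 + 1 / ε, ?_⟩
      rintro _ ⟨s, hs, rfl⟩
      have := h.prob s hs.1
      have h1 : ∫ z, p z.1 ∂(μ s) ≤ ∫ _, 1 / ε ∂(μ s) :=
        integral_mono (hpi ε hε s hs.1) (integrable_const _) fun z => hp2 ε hε z.1
      simp only [integral_const, probReal_univ, one_smul] at h1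
      linarith
    · intro s r U hs hsr hr hU
      have hsT : s ∈ Icc 0 T := ⟨hs, hsr.trans hr⟩
      have hrT : r ∈ Icc 0 T := ⟨hs.trans hsr, hr⟩
      have hsub1 : ∀ a ∈ Icc 0 T, uIcc 0 a ⊆ uIcc 0 T := fun a ha => by
        rw [uIcc_of_le ha.1, uIcc_of_le hT]; exact Icc_subset_Icc_right ha.2
      have hsub2 : uIcc s r ⊆ uIcc 0 T := by
        rw [uIcc_of_le hsr, uIcc_of_le hT]; exact Icc_subset_Icc hs hr
      have e1 : (∫ z, p z.1 ∂(μ r)) - ∫ z, p z.1 ∂(μ s) =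
          ∫ a in s..r, ∫ z, b a z * deriv p z.1 ∂(μ a) := by
        rw [hieq s hsT, hieq r hrT, ← intervalIntegral.integral_interval_sub_left
          (hii.mono_set (hsub1 r hrT)) (hii.mono_set (hsub1 s hsT))]
        ring
      have e2 : (∫ a in (0:ℝ)..r, 3 * (G a + C)) - ∫ a in (0:ℝ)..s, 3 * (G a + C) =
          ∫ a in s..r, 3 * (G a + C) :=
        intervalIntegral.integral_interval_sub_left
          (hk.mono_set (hsub1 r hrT)) (hk.mono_set (hsub1 s hsT))
      have e3 : ∫ a in s..r, ∫ z, b a z * deriv p z.1 ∂(μ a) ≤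
          ∫ a in s..r, U * (3 * (G a + C)) := by
        refine intervalIntegral.integral_mono_on hsr (hii.mono_set hsub2)
          ((hk.mono_set hsub2).const_mul U) fun a ha => ?_
        refine (hrate a ⟨hs.trans ha.1, ha.2.trans hr⟩).trans ?_
        rw [mul_comm]
        have := hG0 a
        exact mul_le_mul_of_nonneg_right (hU a ha) (by positivity)
      rw [intervalIntegral.integral_const_mul] at e3
      simp only [e2]
      linarith
  have hlim : Tendsto (fun n : ℕ => ∫ z, z.1 ^ 2 / (1 + 1 / ((n:ℝ) + 1) * z.1 ^ 2) ∂(μ t)) atTop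
      (𝓝 (∫ z, z.1 ^ 2 ∂(μ t))) := by
    refine tendsto_integral_of_dominated_convergence _
      (fun n => ((hpc (1 / ((n:ℝ) + 1)) (by positivity)).comp continuous_fst).aestronglyMeasurable)
      (h.sq t ht.1) (fun n => Eventually.of_forall fun z => ?_) (Eventually.of_forall fun z => ?_)
    · have hn : (0:ℝ) < 1 / ((n:ℝ) + 1) := by positivity
      rw [Real.norm_eq_abs, abs_of_nonneg (hp0 _ hn _)]
      exact hp1 _ hn _
    · have h1 : Tendsto (fun n : ℕ => 1 + 1 / ((n:ℝ) + 1) * z.1 ^ 2) atTop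
          (𝓝 (1 + 0 * z.1 ^ 2)) :=
        (tendsto_one_div_add_atTop_nhds_zero_nat.mul_const _).const_add _
      have h2 := (tendsto_const_nhds (x := z.1 ^ 2)).div h1 (by simp)
      rw [zero_mul, add_zero, div_one] at h2
      exact h2
  exact le_of_tendsto hlim (Eventually.of_forall fun n => hmain _ (by positivity))

lemma integral_fst_eq (h : TransportCurve μ b V C L) {T : ℝ} (hT : 0 ≤ T)
    (hg : FluxIntegrable μ b T) :
    IntervalIntegrable (fun s => ∫ z, b s z ∂(μ s)) volume 0 T ∧
    ∀ t ∈ Icc 0 T, xc (μ t) = xc (μ 0) + ∫ s in (0:ℝ)..t, ∫ z, b s z ∂(μ s) := by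
  obtain ⟨Q, hQ⟩ := h.exists_second_moment_le hT hg
  have := h.integral_eq_of_growth hT hg (p := fun x => x) (w := fun x => 1 + x ^ 2) (K := 1 + Q)
    (C' := 2) contDiff_id (fun x => by positivity)
    (fun s hs => by have := h.prob s hs.1; exact (integrable_const _).add (h.sq s hs.1))
    (fun s hs => by
      have := h.prob s hs.1
      rw [integral_add (integrable_const _) (h.sq s hs.1)]
      simp [hQ s hs]) (by norm_num)
    (fun x => by nlinarith [sq_abs x, sq_nonneg (|x| - 1)])
    (fun x => by simp only [deriv_id'', abs_one]; nlinarith [sq_abs x, sq_nonneg (|x| - 1)])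
  simpa [xc] using this

lemma integral_sq_eq (h : TransportCurve μ b V C L) {T : ℝ} (hT : 0 ≤ T)
    (hg : FluxIntegrable μ b T) :
    IntervalIntegrable (fun s => ∫ z, b s z * (2 * z.1) ∂(μ s)) volume 0 T ∧
    ∀ t ∈ Icc 0 T, ∫ z, z.1 ^ 2 ∂(μ t) = (∫ z, z.1 ^ 2 ∂(μ 0)) +
      ∫ s in (0:ℝ)..t, ∫ z, b s z * (2 * z.1) ∂(μ s) := by
  obtain ⟨Q, hQ⟩ := h.exists_second_moment_le hT hg
  have := h.integral_eq_of_growth hT hg (p := fun x => x ^ 2) (w := fun x => 1 + x ^ 2)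
    (K := 1 + Q) (C' := 4) (contDiff_id.pow 2) (fun x => by positivity)
    (fun s hs => by have := h.prob s hs.1; exact (integrable_const _).add (h.sq s hs.1))
    (fun s hs => by
      have := h.prob s hs.1
      rw [integral_add (integrable_const _) (h.sq s hs.1)]
      simp [hQ s hs]) (by norm_num)
    (fun x => by rw [abs_of_nonneg (sq_nonneg x)]; nlinarith [sq_nonneg x])
    (fun x => by
      have : deriv (fun x : ℝ => x ^ 2) x = 2 * x := by simp
      rw [this, abs_mul, abs_of_pos (by norm_num : (0:ℝ) < 2)]
      nlinarith [sq_abs x, sq_nonneg (|x| - 1), abs_nonneg x])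
  simpa using this

end TransportCurve

/-- A transport curve whose velocity field depends on the current measure in a Lipschitz way. -/
structure MeanFieldCurve (μ : ℝ → Measure (ℝ × ℝ)) (b : ℝ → ℝ × ℝ → ℝ) (V : ℝ → ℝ → ℝ)
    (C L N : ℝ) : Prop extends TransportCurve μ b V C L where
  N_nonneg : 0 ≤ N
  growth : ∀ s, 0 ≤ s → |V s 0| ≤ N * (1 + ∫ z, z.1 ^ 2 ∂(μ s))
  lip : ∀ s t, 0 ≤ s → 0 ≤ t →
    |(∫ z, b s z ∂(μ s)) - ∫ z, b t z ∂(μ t)| ≤ N * W1 (μ s) (μ t)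
  auto : ∀ s t, 0 ≤ s → 0 ≤ t → μ s = μ t → b s = b t

namespace TransportCurve

variable {μ : ℝ → Measure (ℝ × ℝ)} {b : ℝ → ℝ × ℝ → ℝ} {V : ℝ → ℝ → ℝ} {C L : ℝ}

lemma integrable_fst (h : TransportCurve μ b V C L) {s : ℝ} (hs : 0 ≤ s) :
    Integrable (fun z : ℝ × ℝ => z.1) (μ s) :=
  (h.integrable_abs hs).mono' (by fun_prop) (Eventually.of_forall fun _ => le_rfl)

lemma integrable_velocity (h : TransportCurve μ b V C L) {s : ℝ} (hs : 0 ≤ s) :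
    Integrable (b s) (μ s) := by
  have := h.prob s hs
  exact (((integrable_const 1).add (h.integrable_abs hs)).const_mul _).mono'
    (h.cont s hs).aestronglyMeasurable (h.abs_velocity_le hs)

lemma integrable_velocity_mul_fst (h : TransportCurve μ b V C L) {s : ℝ} (hs : 0 ≤ s) :
    Integrable (fun z => b s z * z.1) (μ s) := by
  refine (((h.integrable_abs hs).add (h.sq s hs)).const_mul (|V s 0| + C)).mono'
    ((h.cont s hs).mul continuous_fst).aestronglyMeasurable ?_
  filter_upwards [h.abs_velocity_le hs] with z hz
  rw [Real.norm_eq_abs, abs_mul]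
  calc _ ≤ (|V s 0| + C) * (1 + |z.1|) * |z.1| := by gcongr
    _ = (|V s 0| + C) * (|z.1| + |z.1| ^ 2) := by ring
    _ = _ := by rw [sq_abs]; rfl

lemma integral_sub_sq (h : TransportCurve μ b V C L) {s : ℝ} (hs : 0 ≤ s) :
    Integrable (fun z : ℝ × ℝ => (z.1 - xc (μ s)) ^ 2) (μ s) ∧
    ∫ z, (z.1 - xc (μ s)) ^ 2 ∂(μ s) = (∫ z, z.1 ^ 2 ∂(μ s)) - xc (μ s) ^ 2 := by
  have := h.prob s hs
  have e : (fun z : ℝ × ℝ => (z.1 - xc (μ s)) ^ 2) =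
      fun z => (z.1 ^ 2 - 2 * xc (μ s) * z.1) + xc (μ s) ^ 2 := by
    funext z; ring
  have i1 : Integrable (fun z : ℝ × ℝ => 2 * xc (μ s) * z.1) (μ s) :=
    (h.integrable_fst hs).const_mul _
  have i2 : Integrable (fun z : ℝ × ℝ => z.1 ^ 2 - 2 * xc (μ s) * z.1) (μ s) :=
    (h.sq s hs).sub i1
  rw [e]
  refine ⟨i2.add (integrable_const _), ?_⟩
  rw [integral_add i2 (integrable_const _), integral_sub (h.sq s hs) i1, integral_const_mul,
    integral_const, probReal_univ, one_smul]
  change _ - 2 * xc (μ s) * xc (μ s) + _ = _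
  ring

lemma abs_covariance_le (h : TransportCurve μ b V C L) {s : ℝ} (hs : 0 ≤ s) :
    |(∫ z, b s z * (2 * z.1) ∂(μ s)) - 2 * xc (μ s) * ∫ z, b s z ∂(μ s)| ≤
      4 * C * (1 + ((∫ z, z.1 ^ 2 ∂(μ s)) - xc (μ s) ^ 2)) := by
  have := h.prob s hs
  obtain ⟨hvi, hv⟩ := h.integral_sub_sq hs
  have hC := h.C_nonneg
  set X := xc (μ s) with hX
  have i1 : Integrable (fun z => b s z * (2 * z.1)) (μ s) := by
    have := (h.integrable_velocity_mul_fst hs).const_mul 2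
    refine this.congr (Eventually.of_forall fun z => ?_)
    change 2 * (b s z * z.1) = _
    ring
  have i2 : Integrable (fun z => 2 * X * b s z) (μ s) := (h.integrable_velocity hs).const_mul _
  have i3 : Integrable (fun z : ℝ × ℝ => 2 * V s X * (z.1 - X)) (μ s) :=
    ((h.integrable_fst hs).sub (integrable_const X)).const_mul _
  have e3 : ∫ z, 2 * V s X * (z.1 - X) ∂(μ s) = 0 := by
    rw [integral_const_mul, integral_sub (h.integrable_fst hs) (integrable_const X),
      integral_const, probReal_univ, one_smul]
    change 2 * V s X * (xc (μ s) - X) = 0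
    rw [← hX]; ring
  have e : (∫ z, b s z * (2 * z.1) ∂(μ s)) - 2 * X * ∫ z, b s z ∂(μ s) =
      ∫ z, (b s z * (2 * z.1) - 2 * X * b s z - 2 * V s X * (z.1 - X)) ∂(μ s) := by
    have i12 : Integrable (fun z => b s z * (2 * z.1) - 2 * X * b s z) (μ s) := i1.sub i2
    rw [integral_sub i12 i3, e3, integral_sub i1 i2, integral_const_mul, sub_zero]
  rw [e, ← Real.norm_eq_abs]
  have i4 : Integrable (fun z : ℝ × ℝ => 1 + (z.1 - X) ^ 2) (μ s) :=
    (integrable_const _).add hvi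
  refine (norm_integral_le_of_norm_le (i4.const_mul (4 * C)) ?_).trans ?_
  · filter_upwards [h.lin s hs X] with z hz
    have e4 : b s z * (2 * z.1) - 2 * X * b s z - 2 * V s X * (z.1 - X) =
      2 * ((z.1 - X) * (b s z - V s X)) := by ring
    rw [e4, Real.norm_eq_abs, abs_mul, abs_mul, abs_of_pos (by norm_num : (0:ℝ) < 2)]
    calc _ ≤ 2 * (|z.1 - X| * (C * (1 + |z.1 - X|))) := by gcongr
      _ = C * (2 * |z.1 - X| + 2 * |z.1 - X| ^ 2) := by ring
      _ ≤ C * (4 * (1 + |z.1 - X| ^ 2)) := by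
        gcongr
        nlinarith [sq_nonneg (|z.1 - X| - 1)]
      _ = _ := by rw [sq_abs]; ring
  · rw [integral_const_mul, integral_add (integrable_const _) hvi, hv, integral_const,
      probReal_univ, one_smul]

end TransportCurve

namespace MeanFieldCurve

open Topology

variable {μ : ℝ → Measure (ℝ × ℝ)} {b : ℝ → ℝ × ℝ → ℝ} {V : ℝ → ℝ → ℝ} {C L N : ℝ}

lemma continuousOn_mean_velocity (h : MeanFieldCurve μ b V C L N) {T : ℝ} (hT : 0 ≤ T)
    (hg : FluxIntegrable μ b T) : ContinuousOn (fun s => ∫ z, b s z ∂(μ s)) (Icc 0 T) := by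
  obtain ⟨Q, hQ⟩ := h.exists_second_moment_le hT hg
  intro t ht
  have hle : ∀ s ∈ Icc 0 T, ∀ᵐ z ∂(μ s), ‖(‖z‖ ^ 2)‖ ≤ z.1 ^ 2 + L ^ 2 := by
    intro s hs
    filter_upwards [h.bdd s hs.1] with z hz
    rw [Real.norm_eq_abs, abs_of_nonneg (by positivity), Prod.norm_def]
    rcases max_cases ‖z.1‖ ‖z.2‖ with ⟨h1, _⟩ | ⟨h1, _⟩ <;> rw [h1, Real.norm_eq_abs]
    · rw [sq_abs]; nlinarith [sq_nonneg L]
    · have := pow_le_pow_left₀ (abs_nonneg _) hz 2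
      nlinarith [sq_nonneg z.1]
  have hint : ∀ s ∈ Icc 0 T, Integrable (fun z : ℝ × ℝ => z.1 ^ 2 + L ^ 2) (μ s) := fun s hs => by
    have := h.prob s hs.1
    exact (h.sq s hs.1).add (integrable_const _)
  have hi : ∀ s ∈ Icc 0 T, Integrable (fun z : ℝ × ℝ => ‖z‖ ^ 2) (μ s) := fun s hs =>
    (hint s hs).mono' (by fun_prop) (hle s hs)
  have hW := tendsto_W1_of_vague (μ := μ) ht (fun s hs => h.prob s hs.1) (K := Q + L ^ 2) hi
    (fun s hs => by
      have := h.prob s hs.1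
      have h1 : ∫ z, ‖z‖ ^ 2 ∂(μ s) ≤ ∫ z, (z.1 ^ 2 + L ^ 2) ∂(μ s) := by
        refine integral_mono_ae (hi s hs) (hint s hs) ?_
        filter_upwards [hle s hs] with z hz using (le_abs_self _).trans hz
      rw [integral_add (h.sq s hs.1) (integrable_const _), integral_const, probReal_univ,
        one_smul] at h1
      linarith [hQ s hs])
    (fun φ hφ hc => (h.vague φ hφ hc t ht.1).mono Icc_subset_Ici_self)
  rw [ContinuousWithinAt, tendsto_iff_dist_tendsto_zero]
  have hW' := hW.const_mul N
  rw [mul_zero] at hW'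
  refine squeeze_zero' (Eventually.of_forall fun _ => dist_nonneg) ?_ hW'
  filter_upwards [self_mem_nhdsWithin] with s hs
  exact h.lip s t hs.1 ht.1

lemma hasDerivWithinAt_xc (h : MeanFieldCurve μ b V C L N) {T t : ℝ}
    (hg : FluxIntegrable μ b T) (ht : t ∈ Icc 0 T) :
    HasDerivWithinAt (fun s => xc (μ s)) (∫ z, b t z ∂(μ t)) (Icc 0 T) t := by
  have hT : 0 ≤ T := ht.1.trans ht.2
  obtain ⟨hi, he⟩ := h.integral_fst_eq hT hg
  have hc := h.continuousOn_mean_velocity hT hg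
  have : Fact (t ∈ Icc 0 T) := ⟨ht⟩
  have h1 := (intervalIntegral.integral_hasDerivWithinAt_right (a := 0) (b := t)
    (f := fun s => ∫ z, b s z ∂(μ s)) (s := Icc 0 T) (t := Icc 0 T)
    (hi.mono_set (by rw [uIcc_of_le ht.1, uIcc_of_le hT]; exact Icc_subset_Icc_right ht.2))
    ⟨Icc 0 T, self_mem_nhdsWithin, hc.aestronglyMeasurable measurableSet_Icc⟩
    (hc t ht)).const_add (xc (μ 0))
  exact h1.congr (fun s hs => he s hs) (he t ht)

lemma variance_sub_le (h : MeanFieldCurve μ b V C L N) {T s t U : ℝ}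
    (hg : FluxIntegrable μ b T) (hs : 0 ≤ s) (hst : s ≤ t) (htT : t ≤ T)
    (hU : ∀ r ∈ Icc s t, 1 + ((∫ z, z.1 ^ 2 ∂(μ r)) - xc (μ r) ^ 2) ≤ U) :
    ((∫ z, z.1 ^ 2 ∂(μ t)) - xc (μ t) ^ 2) ≤
      ((∫ z, z.1 ^ 2 ∂(μ s)) - xc (μ s) ^ 2) + U * (4 * C * t - 4 * C * s) := by
  have hT : 0 ≤ T := hs.trans (hst.trans htT)
  have hC := h.C_nonneg
  obtain ⟨hi2, he2⟩ := h.integral_sq_eq hT hg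
  have hc := h.continuousOn_mean_velocity hT hg
  have hsT : s ∈ Icc 0 T := ⟨hs, hst.trans htT⟩
  have htT' : t ∈ Icc 0 T := ⟨hs.trans hst, htT⟩
  have hsub : Icc s t ⊆ Icc 0 T := Icc_subset_Icc hs htT
  have hsub1 : ∀ a ∈ Icc 0 T, uIcc 0 a ⊆ uIcc 0 T := fun a ha => by
    rw [uIcc_of_le ha.1, uIcc_of_le hT]; exact Icc_subset_Icc_right ha.2
  have hi3 : IntervalIntegrable (fun s => ∫ z, b s z * (2 * z.1) ∂(μ s)) volume s t :=
    hi2.mono_set (by rw [uIcc_of_le hst, uIcc_of_le hT]; exact hsub)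
  have e1 : (∫ z, z.1 ^ 2 ∂(μ t)) - ∫ z, z.1 ^ 2 ∂(μ s) =
      ∫ r in s..t, ∫ z, b r z * (2 * z.1) ∂(μ r) := by
    rw [he2 s hsT, he2 t htT', ← intervalIntegral.integral_interval_sub_left
      (hi2.mono_set (hsub1 t htT')) (hi2.mono_set (hsub1 s hsT))]
    ring
  have hder : ∀ r ∈ Icc s t, HasDerivWithinAt (fun s => xc (μ s) ^ 2)
      (2 * xc (μ r) * ∫ z, b r z ∂(μ r)) (Icc s t) r := fun r hr => by
    simpa using ((h.hasDerivWithinAt_xc hg (hsub hr)).mono hsub).fun_pow 2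
  have hcX : ContinuousOn (fun s => xc (μ s)) (Icc s t) := fun r hr =>
    ((h.hasDerivWithinAt_xc hg (hsub hr)).mono hsub).continuousWithinAt
  have hi4 : IntervalIntegrable (fun r => 2 * xc (μ r) * ∫ z, b r z ∂(μ r)) volume s t := by
    refine ContinuousOn.intervalIntegrable ?_
    rw [uIcc_of_le hst]
    exact (continuousOn_const.mul hcX).mul (hc.mono hsub)
  have e2 : xc (μ t) ^ 2 - xc (μ s) ^ 2 =
      ∫ r in s..t, 2 * xc (μ r) * ∫ z, b r z ∂(μ r) := by
    symm
    refine intervalIntegral.integral_eq_sub_of_hasDerivAt_of_le hst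
      (f := fun s => xc (μ s) ^ 2) (hcX.pow 2) (fun r hr => ?_) hi4
    exact (hder r (Ioo_subset_Icc_self hr)).hasDerivAt (Icc_mem_nhds hr.1 hr.2)
  have e3 := intervalIntegral.integral_mono_on hst (hi3.sub hi4)
    (intervalIntegrable_const (c := 4 * C * U)) fun r hr => by
      refine (le_abs_self _).trans ((h.abs_covariance_le (hs.trans hr.1)).trans ?_)
      exact mul_le_mul_of_nonneg_left (hU r hr) (by positivity)
  rw [intervalIntegral.integral_sub hi3 hi4, intervalIntegral.integral_const, smul_eq_mul,
    ← e1, ← e2] at e3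
  linarith

lemma exists_uniform_second_moment_le (h : MeanFieldCurve μ b V C L N) {T : ℝ} (hT : 0 ≤ T)
    (hg : ∀ s, 0 ≤ s → s < T → FluxIntegrable μ b s) :
    ∃ Q, ∀ s, 0 ≤ s → s < T → ∫ z, z.1 ^ 2 ∂(μ s) ≤ Q := by
  obtain ⟨N', hN'⟩ := exists_le_mul_of_increment_le (T := T) (K := fun t => 4 * C * t)
    (by fun_prop)
  obtain ⟨c, hc, hcT⟩ := h.exists_pos_le hT
  have hv0 : ∀ s, 0 ≤ s → 0 ≤ (∫ z, z.1 ^ 2 ∂(μ s)) - xc (μ s) ^ 2 := fun s hs => by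
    rw [← (h.integral_sub_sq hs).2]; exact integral_nonneg fun z => sq_nonneg _
  set D := N' * (1 + ((∫ z, z.1 ^ 2 ∂(μ 0)) - xc (μ 0) ^ 2)) with hD
  refine ⟨D + 2 * D / c, fun s hs hsT => ?_⟩
  have := h.prob s hs
  have hvar : 1 + ((∫ z, z.1 ^ 2 ∂(μ s)) - xc (μ s) ^ 2) ≤ D := by
    obtain ⟨Q, hQ⟩ := h.exists_second_moment_le hs (hg s hs hsT)
    refine hN' s ⟨hs, hsT.le⟩ (fun s => 1 + ((∫ z, z.1 ^ 2 ∂(μ s)) - xc (μ s) ^ 2))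
      (fun r hr => by linarith [hv0 r hr.1]) ⟨1 + Q, ?_⟩ (fun r t U hr hrt hts hU => ?_)
      s ⟨hs, le_rfl⟩
    · rintro _ ⟨r, hr, rfl⟩
      have := hQ r hr
      simp only
      nlinarith [sq_nonneg (xc (μ r))]
    · have := h.variance_sub_le (hg s hs hsT) hr hrt hts hU
      linarith
  obtain ⟨hvi, hv⟩ := h.integral_sub_sq hs
  set X := xc (μ s) with hX
  have h1 : c ≤ 2 * D / (1 + X ^ 2) := by
    refine (hcT s ⟨hs, hsT.le⟩).trans ?_
    have i1 : Integrable (fun z : ℝ × ℝ => 1 + (z.1 - X) ^ 2) (μ s) :=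
      (integrable_const _).add hvi
    have i2 : Integrable (fun z : ℝ × ℝ => 1 / (1 + z.1 ^ 2)) (μ s) :=
      Integrable.of_bound TransportCurve.continuous_inv_one_add_sq.aestronglyMeasurable 1
        (Eventually.of_forall fun z => TransportCurve.abs_inv_one_add_sq_le z.1)
    have h2 := integral_mono i2 (i1.const_mul (2 / (1 + X ^ 2))) fun z => by
      change 1 / (1 + z.1 ^ 2) ≤ 2 / (1 + X ^ 2) * (1 + (z.1 - X) ^ 2)
      rw [div_mul_eq_mul_div, div_le_div_iff₀ (by positivity) (by positivity)]
      nlinarith [sq_nonneg (2 * z.1 - X), sq_nonneg ((z.1 - X) * z.1), sq_nonneg z.1,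
        sq_nonneg (z.1 - X)]
    rw [integral_const_mul, integral_add (integrable_const _) hvi, hv, integral_const,
      probReal_univ, one_smul] at h2
    refine h2.trans ?_
    rw [div_mul_eq_mul_div]
    gcongr
  have h3 : 1 + X ^ 2 ≤ 2 * D / c := by
    rw [le_div_iff₀ (by positivity)] at h1
    rw [le_div_iff₀ hc]
    linarith
  linarith

lemma fluxIntegrable (h : MeanFieldCurve μ b V C L N) {T : ℝ} (hT : 0 ≤ T) :
    FluxIntegrable μ b T := by
  by_contra hbad
  have hC := h.C_nonneg
  have hN := h.N_nonneg
  set S : Set ℝ := {t | 0 ≤ t ∧ ¬ FluxIntegrable μ b t} with hS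
  have hTS : T ∈ S := ⟨hT, hbad⟩
  have hSb : BddBelow S := ⟨0, fun t ht => ht.1⟩
  set τ := sInf S with hτ
  have hτ0 : 0 ≤ τ := le_csInf ⟨T, hTS⟩ fun t ht => ht.1
  have hgood : ∀ s, 0 ≤ s → s < τ → FluxIntegrable μ b s := fun s hs hsτ => by
    by_contra hb
    exact absurd (csInf_le hSb (⟨hs, hb⟩ : s ∈ S)) (not_le.2 hsτ)
  have hconst : ∀ s, τ < s → μ s = μ 0 := fun s hs => by
    obtain ⟨r, hr, hrs⟩ := exists_lt_of_csInf_lt ⟨T, hTS⟩ hs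
    exact h.eq_initial_of_not_fluxIntegrable hr.1 hr.2 hrs.le
  obtain ⟨Q, hQ⟩ := h.exists_uniform_second_moment_le hτ0 hgood
  set Q' := max Q (∫ z, z.1 ^ 2 ∂(μ 0)) with hQ'
  have hQs : ∀ s, 0 ≤ s → s ≠ τ → ∫ z, z.1 ^ 2 ∂(μ s) ≤ Q' := fun s hs hsτ => by
    rcases lt_or_gt_of_ne hsτ with h1 | h1
    · exact (hQ s hs h1).trans (le_max_left _ _)
    · rw [hconst s h1]; exact le_max_right _ _
  apply hbad
  intro ψ hψ hψc
  rw [intervalIntegrable_iff_integrableOn_Ioc_of_le hT]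
  obtain ⟨E, hE⟩ := ((hasCompactSupport_dx hψ hψc).mul_left
    (f := fun z : ℝ × ℝ => 1 + |z.1|)).exists_bound_of_continuous
    ((by fun_prop : Continuous fun z : ℝ × ℝ => 1 + |z.1|).mul (continuous_dx hψ))
  have hE0 : 0 ≤ E := (norm_nonneg _).trans (hE 0)
  have hbound : ∀ s, 0 ≤ s → s ≠ τ → ‖flux μ b ψ s‖ ≤ (N * (1 + Q') + C) * E := by
    intro s hs hsτ
    have := h.prob s hs
    refine (norm_integral_le_of_norm_le_const (C := (N * (1 + Q') + C) * E) ?_).trans (by simp)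
    filter_upwards [h.abs_velocity_le hs] with z hz
    have hEz := hE z
    simp only [Pi.mul_apply] at hEz
    rw [Real.norm_eq_abs, abs_mul] at hEz ⊢
    rw [abs_of_nonneg (by positivity : 0 ≤ 1 + |z.1|)] at hEz
    have hVs : |V s 0| ≤ N * (1 + Q') := (h.growth s hs).trans (by gcongr; exact hQs s hs hsτ)
    have h0 : 0 ≤ N * (1 + Q') := (abs_nonneg _).trans hVs
    calc _ ≤ (N * (1 + Q') + C) * (1 + |z.1|) * |dx ψ z| := by
          gcongr
          exact hz.trans (by gcongr)
      _ = (N * (1 + Q') + C) * ((1 + |z.1|) * |dx ψ z|) := by ring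
      _ ≤ _ := by gcongr
  have hne : ∀ᵐ s ∂(volume.restrict (Ioc 0 T)), s ≠ τ := by
    refine ae_restrict_of_ae ?_
    simp [ae_iff]
  refine Integrable.mono' (g := fun _ => (N * (1 + Q') + C) * E) (integrable_const _) ?_ ?_
  · have hm1 : ∀ n : ℕ, AEStronglyMeasurable (flux μ b ψ)
        (volume.restrict (Ioc 0 (τ - 1 / ((n:ℝ) + 1)))) := fun n => by
      by_cases hn : 0 ≤ τ - 1 / ((n:ℝ) + 1)
      · have h1 := hgood _ hn (by
          have : (0:ℝ) < 1 / ((n:ℝ) + 1) := by positivity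
          linarith) ψ hψ hψc
        rw [intervalIntegrable_iff_integrableOn_Ioc_of_le hn] at h1
        exact h1.aestronglyMeasurable
      · rw [Ioc_eq_empty (by push Not at hn ⊢; exact hn.le)]
        simp
    have hm2 : AEStronglyMeasurable (flux μ b ψ) (volume.restrict (Ioi τ)) := by
      refine (aestronglyMeasurable_const (b := ∫ z, b 0 z * dx ψ z ∂(μ 0))).congr ?_
      filter_upwards [ae_restrict_mem measurableSet_Ioi] with s hs
      have hs0 : 0 ≤ s := hτ0.trans (le_of_lt hs)
      rw [flux, h.auto s 0 hs0 le_rfl (hconst s hs), hconst s hs]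
    have hm3 : AEStronglyMeasurable (flux μ b ψ)
        (volume.restrict ((⋃ n : ℕ, Ioc 0 (τ - 1 / ((n:ℝ) + 1))) ∪ ({τ} ∪ Ioi τ))) := by
      refine aestronglyMeasurable_union_iff.2 ⟨aestronglyMeasurable_iUnion_iff.2 hm1,
        aestronglyMeasurable_union_iff.2 ⟨?_, hm2⟩⟩
      have : volume.restrict {τ} = 0 := by simp
      rw [this]
      exact aestronglyMeasurable_zero_measure _
    refine hm3.mono_measure (Measure.restrict_mono (fun s hs => ?_) le_rfl)
    rcases lt_trichotomy s τ with h1 | h1 | h1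
    · left
      obtain ⟨n, hn⟩ := exists_nat_one_div_lt (sub_pos.2 h1)
      exact mem_iUnion.2 ⟨n, hs.1, by linarith⟩
    · right; left; exact h1
    · right; right; exact h1
  · filter_upwards [ae_restrict_mem measurableSet_Ioc, hne] with s hs hsτ
    exact hbound s hs.1.le hsτ

lemma hasDerivWithinAt_xc_Ici (h : MeanFieldCurve μ b V C L N) {t : ℝ} (ht : 0 ≤ t) :
    HasDerivWithinAt (fun s => xc (μ s)) (∫ z, b t z ∂(μ t)) (Ici 0) t := by
  have h1 := h.hasDerivWithinAt_xc (h.fluxIntegrable (by linarith : 0 ≤ t + 1))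
    ⟨ht, by linarith⟩
  refine h1.mono_of_mem_nhdsWithin ?_
  rw [← Ici_inter_Iic]
  exact inter_mem_nhdsWithin _ (Iic_mem_nhds (by linarith))

end MeanFieldCurve

section Framework

variable {ν : Measure ℝ} {A B I M κ γ : ℝ} {F : Measure (ℝ × ℝ) → ℝ × ℝ → ℝ}
  {μ μ' : Measure (ℝ × ℝ)}

lemma abs_sub_le_of_mem_msupp (hΩ : Bornology.IsBounded (msupp ν))
    (hγ : γ = sSup {d : ℝ | ∃ ω ∈ msupp ν, ∃ ω' ∈ msupp ν, d = |ω - ω'|}) {ω ω' : ℝ}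
    (h : ω ∈ msupp ν) (h' : ω' ∈ msupp ν) : |ω - ω'| ≤ γ := by
  rw [hγ]
  refine le_csSup ⟨Metric.diam (msupp ν), ?_⟩ ⟨ω, h, ω', h', rfl⟩
  rintro _ ⟨a, ha, a', ha', rfl⟩
  exact Metric.dist_le_diam_of_mem hΩ ha ha'

lemma P2nu.ae_snd_mem (h : μ ∈ P2nu ν) : ∀ᵐ z ∂μ, z.2 ∈ msupp ν := by
  have h1 := ae_mem_msupp ν
  rw [← h.2.2] at h1
  rw [← h.2.2]
  exact ae_of_ae_map measurable_snd.aemeasurable h1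

lemma P2nu.integrable_sq_fst (h : μ ∈ P2nu ν) : Integrable (fun z : ℝ × ℝ => z.1 ^ 2) μ :=
  h.2.1.mono' (by fun_prop) (Eventually.of_forall fun z => by
    rw [Real.norm_eq_abs, abs_of_nonneg (sq_nonneg _)]
    linarith [sq_nonneg z.2])

lemma norm_le_one_add_sq (z : ℝ × ℝ) : ‖z‖ ≤ 1 + (z.1 ^ 2 + z.2 ^ 2) := by
  rw [Prod.norm_def, Real.norm_eq_abs, Real.norm_eq_abs]
  refine max_le ?_ ?_
  · nlinarith [sq_abs z.1, sq_nonneg (|z.1| - 1), sq_nonneg z.1, sq_nonneg z.2]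
  · nlinarith [sq_abs z.2, sq_nonneg (|z.2| - 1), sq_nonneg z.1, sq_nonneg z.2]

lemma P2nu.integrable_norm (h : μ ∈ P2nu ν) : Integrable (fun z : ℝ × ℝ => ‖z‖) μ := by
  have := h.1
  refine ((integrable_const 1).add h.2.1).mono' (by fun_prop) (Eventually.of_forall fun z => ?_)
  rw [norm_norm]
  exact norm_le_one_add_sq z

lemma Framework.abs_sub_le (hF : Framework ν F A B I M κ γ) (h : μ ∈ P2nu ν) (x x' ω ω' : ℝ) :
    |F μ (x, ω) - F μ (x', ω')| ≤ κ * I * |x - x'| + I * |ω - ω'| := by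
  obtain ⟨hd, hx, -, hw⟩ := hF.hA2 μ h
  have hd' := hd.differentiable two_ne_zero
  have h1 : |F μ (x, ω) - F μ (x', ω)| ≤ κ * I * |x - x'| :=
    convex_univ.norm_image_sub_le_of_norm_deriv_le (f := fun x => F μ (x, ω)) (𝕜 := ℝ)
      (fun y _ => (hd'.comp (differentiable_id.prodMk (differentiable_const ω))) y)
      (fun y _ => hx (y, ω)) (mem_univ x') (mem_univ x)
  have h2 : |F μ (x', ω) - F μ (x', ω')| ≤ I * |ω - ω'| :=
    convex_univ.norm_image_sub_le_of_norm_deriv_le (f := fun w => F μ (x', w)) (𝕜 := ℝ)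
      (fun y _ => (hd'.comp ((differentiable_const x').prodMk differentiable_id)) y)
      (fun y _ => hw (x', y)) (mem_univ ω') (mem_univ ω)
  exact (_root_.abs_sub_le _ _ _).trans (add_le_add h1 h2)

lemma Framework.abs_sub_le_dist (hF : Framework ν F A B I M κ γ) (hI : 0 < I) (hκ : 0 < κ)
    (h : μ ∈ P2nu ν) (z z' : ℝ × ℝ) : |F μ z - F μ z'| ≤ (κ + 1) * I * dist z z' := by
  have h1 := hF.abs_sub_le h z.1 z'.1 z.2 z'.2
  have h2 : |z.1 - z'.1| ≤ dist z z' := by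
    rw [Prod.dist_eq, Real.dist_eq]; exact le_max_left _ _
  have h3 : |z.2 - z'.2| ≤ dist z z' := by
    rw [Prod.dist_eq, Real.dist_eq, Real.dist_eq]; exact le_max_right _ _
  have h4 : κ * I * |z.1 - z'.1| ≤ κ * I * dist z z' := by gcongr
  have h5 : I * |z.2 - z'.2| ≤ I * dist z z' := by gcongr
  simp only [Prod.mk.eta] at h1
  linarith

lemma Framework.integrable (hF : Framework ν F A B I M κ γ) (hI : 0 < I) (hκ : 0 < κ)
    (h : μ ∈ P2nu ν) (h' : μ' ∈ P2nu ν) : Integrable (F μ) μ' := by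
  have := h'.1
  refine ((integrable_const |F μ 0|).add ((P2nu.integrable_norm h').const_mul
    ((κ + 1) * I))).mono' (hF.hA2 μ h).1.continuous.aestronglyMeasurable
    (Eventually.of_forall fun z => ?_)
  have h1 := hF.abs_sub_le_dist hI hκ h z 0
  rw [dist_zero_right] at h1
  have h2 := abs_sub_abs_le_abs_sub (F μ z) (F μ 0)
  simp only [Pi.add_apply, Real.norm_eq_abs (F μ z)]
  linarith

lemma Framework.abs_integral_sub_le (hF : Framework ν F A B I M κ γ) (hI : 0 < I) (hκ : 0 < κ)
    (h : μ ∈ P2nu ν) (h' : μ' ∈ P2nu ν) :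
    |(∫ z, F μ z ∂μ) - ∫ z, F μ' z ∂μ'| ≤ ((κ + 1) * I + κ * M) * W1 μ μ' := by
  have := h.1
  have := h'.1
  have h1 : |(∫ z, F μ z ∂μ) - ∫ z, F μ z ∂μ'| ≤ (κ + 1) * I * W1 μ μ' :=
    abs_integral_sub_le_W1 (by positivity) (hF.abs_sub_le_dist hI hκ h) (hF.integrable hI hκ h h)
      (hF.integrable hI hκ h h') (P2nu.integrable_norm h) (P2nu.integrable_norm h')
  have h2 : |(∫ z, F μ z ∂μ') - ∫ z, F μ' z ∂μ'| ≤ κ * M * W1 μ μ' := by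
    rw [← integral_sub (hF.integrable hI hκ h h') (hF.integrable hI hκ h' h'),
      ← Real.norm_eq_abs]
    refine (norm_integral_le_of_norm_le_const (C := κ * M * W1 μ μ') ?_).trans (by simp)
    filter_upwards [P2nu.ae_snd_mem h'] with z hz using (hF.hA1 μ h μ' h' z.1 z.2 hz).1
  have := _root_.abs_sub_le (∫ z, F μ z ∂μ) (∫ z, F μ z ∂μ') (∫ z, F μ' z ∂μ')
  linarith

lemma diracProd_eq_map [SFinite ν] (x : ℝ) : diracProd x ν = ν.map (Prod.mk x) :=
  Measure.dirac_prod x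

lemma integrable_id_of_isBounded [IsFiniteMeasure ν] (hΩ : Bornology.IsBounded (msupp ν)) :
    Integrable (fun ω => ω) ν ∧ Integrable (fun ω => ω ^ 2) ν := by
  obtain ⟨L, hL⟩ := hΩ.exists_norm_le
  constructor
  · refine Integrable.of_bound (by fun_prop) L ?_
    filter_upwards [ae_mem_msupp ν] with ω hω using hL ω hω
  · refine Integrable.of_bound (by fun_prop) (L ^ 2) ?_
    filter_upwards [ae_mem_msupp ν] with ω hω
    rw [norm_pow]
    exact pow_le_pow_left₀ (norm_nonneg _) (hL ω hω) 2

lemma diracProd_mem_P2nu [IsProbabilityMeasure ν] (hΩ : Bornology.IsBounded (msupp ν)) (x : ℝ) :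
    diracProd x ν ∈ P2nu ν := by
  refine ⟨by unfold diracProd; infer_instance, ?_, ?_⟩
  · rw [diracProd_eq_map, integrable_map_measure (by fun_prop) (by fun_prop)]
    exact (integrable_const (x ^ 2)).add (integrable_id_of_isBounded hΩ).2
  · rw [diracProd_eq_map, Measure.map_map measurable_snd measurable_prodMk_left]
    exact Measure.map_id

lemma abs_sub_wc_le [IsProbabilityMeasure ν] (hΩ : Bornology.IsBounded (msupp ν))
    (hγ : γ = sSup {d : ℝ | ∃ ω ∈ msupp ν, ∃ ω' ∈ msupp ν, d = |ω - ω'|}) {ω : ℝ}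
    (h : ω ∈ msupp ν) : |ω - wc ν| ≤ γ := by
  have e : ω - wc ν = ∫ ω', (ω - ω') ∂ν := by
    rw [integral_sub (integrable_const _) (integrable_id_of_isBounded hΩ).1, integral_const,
      probReal_univ, one_smul, wc]
  rw [e, ← Real.norm_eq_abs]
  refine (norm_integral_le_of_norm_le_const (C := γ) ?_).trans (by simp)
  filter_upwards [ae_mem_msupp ν] with ω' h' using abs_sub_le_of_mem_msupp hΩ hγ h h'

lemma Framework.abs_integral_diracProd_sub_le [IsProbabilityMeasure ν]
    (hF : Framework ν F A B I M κ γ) (hI : 0 < I) (hΩ : Bornology.IsBounded (msupp ν))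
    (hγ : γ = sSup {d : ℝ | ∃ ω ∈ msupp ν, ∃ ω' ∈ msupp ν, d = |ω - ω'|})
    (hκ : 0 < κ) (x : ℝ) :
    |(∫ z, F (diracProd x ν) z ∂(diracProd x ν)) - F (diracProd x ν) (x, wc ν)| ≤ I * γ := by
  have hm := diracProd_mem_P2nu hΩ x
  have hc := (hF.hA2 _ hm).1.continuous
  have hi : Integrable (fun ω => F (diracProd x ν) (x, ω)) ν := by
    have h1 := hF.integrable hI hκ hm hm
    have h2 : Integrable (F (diracProd x ν)) (ν.map (Prod.mk x)) := by
      rwa [diracProd_eq_map] at h1 ⊢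
    exact (integrable_map_measure hc.aestronglyMeasurable (by fun_prop)).1 h2
  have e : ∫ z, F (diracProd x ν) z ∂(diracProd x ν) = ∫ ω, F (diracProd x ν) (x, ω) ∂ν := by
    have h3 := integral_map (μ := ν) (φ := Prod.mk x) (by fun_prop)
      (f := F (diracProd x ν)) hc.aestronglyMeasurable
    rwa [← diracProd_eq_map] at h3
  have e2 : (∫ ω, F (diracProd x ν) (x, ω) ∂ν) - F (diracProd x ν) (x, wc ν) =
      ∫ ω, (F (diracProd x ν) (x, ω) - F (diracProd x ν) (x, wc ν)) ∂ν := by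
    rw [integral_sub hi (integrable_const _), integral_const, probReal_univ, one_smul]
  rw [e, e2, ← Real.norm_eq_abs]
  refine (norm_integral_le_of_norm_le_const (C := I * γ) ?_).trans (by simp)
  filter_upwards [ae_mem_msupp ν] with ω hω
  have h1 := hF.abs_sub_le hm x x ω (wc ν)
  rw [sub_self, abs_zero, mul_zero, zero_add] at h1
  exact h1.trans (mul_le_mul_of_nonneg_left (abs_sub_wc_le hΩ hγ hω) hI.le)

lemma Framework.exists_meanFieldCurve [IsProbabilityMeasure ν]
    (hF : Framework ν F A B I M κ γ) (hI : 0 < I) (hM : 0 < M) (hκ : 0 < κ) (hγ0 : 0 < γ)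
    (hΩ : Bornology.IsBounded (msupp ν))
    (hγ : γ = sSup {d : ℝ | ∃ ω ∈ msupp ν, ∃ ω' ∈ msupp ν, d = |ω - ω'|})
    {μ : ℝ → Measure (ℝ × ℝ)} (hsol : IsSol F μ) (hP : ∀ t : ℝ, 0 ≤ t → μ t ∈ P2nu ν) :
    ∃ V C L N, MeanFieldCurve μ (fun s => F (μ s)) V C L N := by
  obtain ⟨ω₀, hω₀⟩ := (ae_mem_msupp ν).exists
  obtain ⟨L, hL0, hL⟩ := hΩ.exists_pos_norm_le
  have hbdd : ∀ s, 0 ≤ s → ∀ᵐ z ∂(μ s), |z.2| ≤ L := fun s hs => by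
    filter_upwards [P2nu.ae_snd_mem (hP s hs)] with z hz using hL _ hz
  have hR : 0 ≤ ∫ z, ‖z‖ ∂(μ 0) := integral_nonneg fun _ => norm_nonneg _
  refine ⟨fun s y => F (μ s) (y, ω₀), κ * I + I * γ, L,
    |F (μ 0) (0, ω₀)| + κ * M * (1 + L + ∫ z, ‖z‖ ∂(μ 0)) + ((κ + 1) * I + κ * M),
    { C_nonneg := by positivity
      L_pos := hL0
      prob := fun s hs => (hP s hs).1
      sq := fun s hs => P2nu.integrable_sq_fst (hP s hs)
      cont := fun s hs => (hF.hA2 _ (hP s hs)).1.continuous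
      lin := fun s hs y => ?_
      bdd := hbdd
      vague := hsol.1
      weak := hsol.2
      N_nonneg := by positivity
      growth := fun s hs => ?_
      lip := fun s t hs ht => ?_
      auto := fun s t _ _ hst => by simp only [hst] }⟩
  · filter_upwards [P2nu.ae_snd_mem (hP s hs)] with z hz
    have h1 := hF.abs_sub_le (hP s hs) z.1 y z.2 ω₀
    have h2 : I * |z.2 - ω₀| ≤ I * γ :=
      mul_le_mul_of_nonneg_left (abs_sub_le_of_mem_msupp hΩ hγ hz hω₀) hI.le
    have h3 : 0 ≤ I * γ * |z.1 - y| := by positivity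
    have h4 : 0 < κ * I := by positivity
    simp only [Prod.mk.eta] at h1
    linarith
  · have := (hP s hs).1
    have := (hP 0 le_rfl).1
    set q := ∫ z, z.1 ^ 2 ∂(μ s) with hq
    have hq0 : 0 ≤ q := integral_nonneg fun z => sq_nonneg _
    have h1 := (hF.hA1 _ (hP s hs) _ (hP 0 le_rfl) 0 ω₀ hω₀).1
    have h2 := W1_le_add (P2nu.integrable_norm (hP s hs)) (P2nu.integrable_norm (hP 0 le_rfl))
    have h3 : ∫ z, ‖z‖ ∂(μ s) ≤ (1 + L) + q := by
      have h4 : ∫ z, ‖z‖ ∂(μ s) ≤ ∫ z, ((1 + L) + z.1 ^ 2) ∂(μ s) := by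
        refine integral_mono_ae (P2nu.integrable_norm (hP s hs))
          ((integrable_const _).add (P2nu.integrable_sq_fst (hP s hs))) ?_
        filter_upwards [hbdd s hs] with z hz
        rw [Prod.norm_def, Real.norm_eq_abs, Real.norm_eq_abs]
        refine max_le ?_ ?_
        · nlinarith [sq_abs z.1, sq_nonneg (|z.1| - 1), sq_nonneg z.1]
        · nlinarith [sq_nonneg z.1]
      rwa [integral_add (integrable_const _) (P2nu.integrable_sq_fst (hP s hs)), integral_const,
        probReal_univ, one_smul] at h4
    have h5 : κ * M * W1 (μ s) (μ 0) ≤ κ * M * ((1 + L) + q + ∫ z, ‖z‖ ∂(μ 0)) := by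
      gcongr; linarith
    have h6 := abs_sub_abs_le_abs_sub (F (μ s) (0, ω₀)) (F (μ 0) (0, ω₀))
    have h7 : 0 ≤ |F (μ 0) (0, ω₀)| * q := by positivity
    have h8 : 0 ≤ κ * M * (L + ∫ z, ‖z‖ ∂(μ 0)) * q := by positivity
    have h9 : 0 ≤ ((κ + 1) * I + κ * M) * (1 + q) := by positivity
    linarith
  · refine (hF.abs_integral_sub_le hI hκ (hP s hs) (hP t ht)).trans
      (mul_le_mul_of_nonneg_right ?_ W1_nonneg)
    have : 0 ≤ |F (μ 0) (0, ω₀)| + κ * M * (1 + L + ∫ z, ‖z‖ ∂(μ 0)) := by positivity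
    linarith

end Framework

/-- With `μ̃_t := δ_{x_c(t)} ⊗ ν`, the derivative of the barycenter
satisfies `|d/dt x_c(t) − F[μ̃_t](x_c(t), ω_c)| ≤ ((κ+1)I + κM) W₁(μ_t, μ̃_t) + Iγ`
for all `t ≥ 0`. -/
theorem barycenter_approximation
    (ν : Measure ℝ) [IsProbabilityMeasure ν]
    (hΩ : Bornology.IsBounded (msupp ν))
    (A B I M κ γ : ℝ)
    (hpos : 0 < A ∧ 0 < B ∧ 0 < I ∧ 0 < M ∧ 0 < κ ∧ 0 < γ)
    (hγ : γ = sSup {d : ℝ | ∃ ω ∈ msupp ν, ∃ ω' ∈ msupp ν, d = |ω - ω'|})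
    (F : Measure (ℝ × ℝ) → ℝ × ℝ → ℝ) (hF : Framework ν F A B I M κ γ)
    (μ : ℝ → Measure (ℝ × ℝ)) (hsol : IsSol F μ)
    (hP : ∀ t : ℝ, 0 ≤ t → μ t ∈ P2nu ν) :
    ∃ xc' : ℝ → ℝ,
      (∀ t : ℝ, 0 ≤ t → HasDerivWithinAt (fun τ => xc (μ τ)) (xc' t) (Ici 0) t) ∧
      (∀ t : ℝ, 0 ≤ t →
        |xc' t - F (diracProd (xc (μ t)) ν) (xc (μ t), wc ν)| ≤
          ((κ + 1) * I + κ * M) * W1 (μ t) (diracProd (xc (μ t)) ν) + I * γ) := by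
  obtain ⟨-, -, hI, hM, hκ, hγ0⟩ := hpos
  obtain ⟨V, C, L, N, h⟩ := hF.exists_meanFieldCurve hI hM hκ hγ0 hΩ hγ hsol hP
  refine ⟨fun t => ∫ z, F (μ t) z ∂(μ t), fun t ht => h.hasDerivWithinAt_xc_Ici ht,
    fun t ht => ?_⟩
  have h1 := hF.abs_integral_sub_le hI hκ (hP t ht) (diracProd_mem_P2nu hΩ (xc (μ t)))
  have h2 := hF.abs_integral_diracProd_sub_le hI hΩ hγ hκ (xc (μ t))
  exact (abs_sub_le _ _ _).trans (add_le_add h1 h2)
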